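/- arXiv:1402.6873 — 2 statements merged into one kernel-verified Lean document; each statement's English description precedes it below -/
import Mathlib

section
/- For every rational number s ∈ I_1(r;n) ∪ I_2(r;n) and every integer t ≥ 1, u_s^t ≠ 1 in Heck(r;n) = ⟨a, b | u_r^n⟩; in other words, u_s is not a torsion element of the even Heckoid group (and in particular u_s has infinite order). -/
/- Formalization of statements from "Homotopically equivalent simple loops on
2-bridge spheres in Heckoid orbifolds for 2-bridge links (II)" by Lee-Sakuma.

We work in the free group `F` on two generators `a = gen 0`, `b = gen 1`.
For a rational `s` (in lowest terms `q/p`, with `0 ≤ s ≤ 1`), `uWord s` is the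
word `u_s = a b^{ε₁} a^{ε₂} ⋯ b^{ε_{2p-1}}` with `ε_i = (-1)^⌊i·s⌋`.
`CS s` is (a linear representative of) the cyclic sequence of lengths of
maximal constant-sign runs of exponents of `u_s`; since `u_s` begins with a
positive letter and (for `0 < s ≤ 1`) ends with a negative letter, the linear
run-length sequence represents the cyclic one.  `CyclicContains L T` says the
cyclic sequence represented by `L` contains `T` as a block of consecutive
terms.  `cfQ [m₁,…,m_k]` is the continued fraction `1/(m₁+1/(m₂+⋯+1/m_k))`.
`memI1 M n s` / `memI2 M n s` express `s ∈ I₁(r;n)` / `s ∈ I₂(r;n)` where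
`r = cfQ M`, and `memI1hat` / `memI2hat` express `s ∈ I₁(r)` / `s ∈ I₂(r)`.
The Heckoid group `Heck(r;n) = ⟨a,b | u_r^n⟩` is the quotient of `F` by the
normal closure `heckN r n` of `u_r^n`, with quotient map `heckQ r n`. -/

namespace Heckoid

abbrev F : Type := FreeGroup (Fin 2)

/-- The generators: `gen 0 = a`, `gen 1 = b` (and `gen i` depends on parity). -/
def gen (i : ℕ) : F := FreeGroup.of ⟨i % 2, Nat.mod_lt _ (by norm_num)⟩

/-- The word `u_s = a b^{ε₁} a^{ε₂} b^{ε₃} ⋯ a^{ε_{2p-2}} b^{ε_{2p-1}}`,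
where `s = q/p` in lowest terms and `ε_i = (-1)^⌊iq/p⌋`. -/
def uWord (s : ℚ) : F :=
  ((List.range (2 * s.den)).map
    (fun i => gen i ^ ((-1 : ℤ) ^ (⌊(i : ℚ) * s⌋.toNat)))).prod

/-- The sequence of exponent signs `ε₀, ε₁, …, ε_{2p-1}` of `u_s`. -/
def signList (s : ℚ) : List ℤ :=
  (List.range (2 * s.den)).map (fun i => (-1 : ℤ) ^ (⌊(i : ℚ) * s⌋.toNat))

/-- Lengths of the maximal runs of equal consecutive entries. -/
def runLengths {α : Type} [BEq α] (l : List α) : List ℕ :=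
  (l.splitBy (· == ·)).map List.length

/-- `CS s = CS(u_s)`: the cyclic sequence of lengths of maximal constant-sign
runs of `u_s`, represented by a list. -/
def CS (s : ℚ) : List ℕ := runLengths (signList s)

/-- The cyclic sequence represented by `L` contains `T` as a block of
consecutive terms. -/
def CyclicContains (L T : List ℕ) : Prop := ∃ k, T <+: L.rotate k

/-- The continued fraction `[m₁, m₂, …, m_k] = 1/(m₁+1/(m₂+⋯+1/m_k))`. -/
def cfQ : List ℕ → ℚ
  | [] => 0
  | a :: l => 1 / ((a : ℚ) + cfQ l)

/-- `d⟨T, T'⟩`: `d` consecutive repetitions of the concatenation of `T` and `T'`. -/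
def rep2 (d : ℕ) (T T' : List ℕ) : List ℕ := (List.replicate d (T ++ T')).flatten

/-- `s ∈ I₁(r;n)` where `r = cfQ M`:  `[0, [m₁,…,m_{k-1},m_k-1,2]]` for `k` even,
`[0, [m₁,…,m_k,2n-2])` for `k` odd. -/
def memI1 (M : List ℕ) (n : ℕ) (s : ℚ) : Prop :=
  if Even M.length then 0 ≤ s ∧ s ≤ cfQ (M.dropLast ++ [M.getLast! - 1, 2])
  else 0 ≤ s ∧ s < cfQ (M ++ [2 * n - 2])

/-- `s ∈ I₂(r;n)` where `r = cfQ M`: `([m₁,…,m_k,2n-2], 1]` for `k` even,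
`[[m₁,…,m_{k-1},m_k-1,2], 1]` for `k` odd. -/
def memI2 (M : List ℕ) (n : ℕ) (s : ℚ) : Prop :=
  if Even M.length then cfQ (M ++ [2 * n - 2]) < s ∧ s ≤ 1
  else cfQ (M.dropLast ++ [M.getLast! - 1, 2]) ≤ s ∧ s ≤ 1

/-- `s ∈ I₁(r)` where `r = cfQ M`. -/
def memI1hat (M : List ℕ) (s : ℚ) : Prop :=
  if Even M.length then 0 ≤ s ∧ s ≤ cfQ (M.dropLast ++ [M.getLast! - 1])
  else 0 ≤ s ∧ s ≤ cfQ M.dropLast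

/-- `s ∈ I₂(r)` where `r = cfQ M`. -/
def memI2hat (M : List ℕ) (s : ℚ) : Prop :=
  if Even M.length then cfQ M.dropLast ≤ s ∧ s ≤ 1
  else cfQ (M.dropLast ++ [M.getLast! - 1]) ≤ s ∧ s ≤ 1

/-- The normal closure of `u_r^n`, so that `Heck(r;n) = F ⧸ heckN r n`. -/
abbrev heckN (r : ℚ) (n : ℕ) : Subgroup F := Subgroup.normalClosure {uWord r ^ n}

/-- The quotient map `F → Heck(r;n) = ⟨a, b | u_r^n⟩`. -/
def heckQ (r : ℚ) (n : ℕ) : F →* F ⧸ heckN r n := QuotientGroup.mk' (heckN r n)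

/-- Two fractions `q₁/p₁ < q₂/p₂` in `[0, 1]` that are joined by an edge of the Farey graph. -/
structure IsFarey (q₁ p₁ q₂ p₂ : ℕ) : Prop where
  det : q₂ * p₁ = q₁ * p₂ + 1
  pos : 0 < p₂
  le_left : q₁ ≤ p₁
  le_right : q₂ ≤ p₂

namespace IsFarey

variable {q₁ p₁ q₂ p₂ : ℕ}

lemma pos_left (h : IsFarey q₁ p₁ q₂ p₂) : 0 < p₁ := by
  rcases Nat.eq_zero_or_pos p₁ with h0 | h0
  · have := h.det
    simp [h0] at this
  · exact h0

lemma mediant_right (h : IsFarey q₁ p₁ q₂ p₂) : IsFarey (q₁ + q₂) (p₁ + p₂) q₂ p₂ where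
  det := by have := h.det; linarith
  pos := h.pos
  le_left := Nat.add_le_add h.le_left h.le_right
  le_right := h.le_right

lemma left_mediant (h : IsFarey q₁ p₁ q₂ p₂) : IsFarey q₁ p₁ (q₁ + q₂) (p₁ + p₂) where
  det := by have := h.det; linarith
  pos := Nat.add_pos_right _ h.pos
  le_left := h.le_left
  le_right := Nat.add_le_add h.le_left h.le_right

/-- Every reduced fraction between two Farey neighbours is a primitive combination of them. -/
lemma exists_coords (h : IsFarey q₁ p₁ q₂ p₂) {u v : ℕ} (huv : u.Coprime v)
    (h₁ : q₁ * v ≤ u * p₁) (h₂ : u * p₂ ≤ q₂ * v) :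
    ∃ i j : ℕ, i.Coprime j ∧ u = i * q₁ + j * q₂ ∧ v = i * p₁ + j * p₂ := by
  obtain ⟨j, hj⟩ := Nat.exists_eq_add_of_le h₁
  obtain ⟨i, hi⟩ := Nat.exists_eq_add_of_le h₂
  have hd : (q₂ : ℤ) * p₁ = q₁ * p₂ + 1 := by exact_mod_cast h.det
  have hj' : (u : ℤ) * p₁ = q₁ * v + j := by exact_mod_cast hj
  have hi' : (q₂ : ℤ) * v = u * p₂ + i := by exact_mod_cast hi
  have hu : u = i * q₁ + j * q₂ := by
    zify
    linear_combination (-(u : ℤ)) * hd + (q₂ : ℤ) * hj' + (q₁ : ℤ) * hi'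
  have hv : v = i * p₁ + j * p₂ := by
    zify
    linear_combination (-(v : ℤ)) * hd + (p₂ : ℤ) * hj' + (p₁ : ℤ) * hi'
  refine ⟨i, j, ?_, hu, hv⟩
  have hgu : i.gcd j ∣ u := by
    rw [hu]
    exact dvd_add ((Nat.gcd_dvd_left i j).mul_right _) ((Nat.gcd_dvd_right i j).mul_right _)
  have hgv : i.gcd j ∣ v := by
    rw [hv]
    exact dvd_add ((Nat.gcd_dvd_left i j).mul_right _) ((Nat.gcd_dvd_right i j).mul_right _)
  exact Nat.eq_one_of_dvd_coprimes huv hgu hgv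

lemma eq_right (h : IsFarey q₁ p₁ q₂ p₂) {u v : ℕ} (huv : u.Coprime v)
    (h₁ : q₂ * v ≤ u * p₂) (h₂ : u * p₂ ≤ q₂ * v) : u = q₂ ∧ v = p₂ := by
  have hd := h.det
  have hp := h.pos
  obtain ⟨i, k, hik, rfl, rfl⟩ := h.exists_coords huv (by
    have h' : q₁ * p₂ * v ≤ u * p₁ * p₂ := by nlinarith
    nlinarith) h₂
  have hi : i * (q₂ * p₁) ≤ i * (q₁ * p₂) := by nlinarith
  rw [hd] at hi
  obtain rfl : i = 0 := by nlinarith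
  obtain rfl : k = 1 := by simpa using hik
  simp

end IsFarey

/-- A function on reduced fractions in `[0, 1]` satisfying the trace relations of a representation
of the once-punctured torus group for which the element of slope `∞` has trace zero. -/
structure IsMarkoff (T : ℕ → ℕ → ℝ) : Prop where
  base : T 1 2 = T 0 1 * T 1 1
  left : ∀ {q₁ p₁ q₂ p₂ : ℕ}, IsFarey q₁ p₁ q₂ p₂ →
    T (q₁ + (q₁ + q₂)) (p₁ + (p₁ + p₂)) = T q₁ p₁ * T (q₁ + q₂) (p₁ + p₂) - T q₂ p₂
  right : ∀ {q₁ p₁ q₂ p₂ : ℕ}, IsFarey q₁ p₁ q₂ p₂ →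
    T (q₁ + q₂ + q₂) (p₁ + p₂ + p₂) = T q₂ p₂ * T (q₁ + q₂) (p₁ + p₂) - T q₁ p₁

namespace IsMarkoff

variable {T : ℕ → ℕ → ℝ}

lemma three_le_combination (hT : IsMarkoff T) (N : ℕ) :
    ∀ {q₁ p₁ q₂ p₂ : ℕ}, IsFarey q₁ p₁ q₂ p₂ → 3 ≤ T q₁ p₁ → 3 ≤ T q₂ p₂ →
      T q₁ p₁ ≤ T (q₁ + q₂) (p₁ + p₂) → T q₂ p₂ ≤ T (q₁ + q₂) (p₁ + p₂) →
      ∀ i j : ℕ, i + j ≤ N → i.Coprime j → 3 ≤ T (i * q₁ + j * q₂) (i * p₁ + j * p₂) := by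
  induction N with
  | zero =>
    intro q₁ p₁ q₂ p₂ _ _ _ _ _ i j hij hc
    obtain ⟨rfl, rfl⟩ : i = 0 ∧ j = 0 := by omega
    simp at hc
  | succ N ih =>
    intro q₁ p₁ q₂ p₂ hF h₁ h₂ hm₁ hm₂ i j hij hc
    rcases Nat.eq_zero_or_pos i with rfl | hi
    · obtain rfl : j = 1 := by simpa using hc
      simpa using h₂
    rcases Nat.eq_zero_or_pos j with rfl | hj
    · obtain rfl : i = 1 := by simpa using hc
      simpa using h₁
    rcases lt_trichotomy i j with hlt | rfl | hlt
    · obtain ⟨k, rfl⟩ := Nat.exists_eq_add_of_le hlt.le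
      have key := ih hF.mediant_right (by linarith) h₂
        (by rw [hT.right hF]; nlinarith) (by rw [hT.right hF]; nlinarith) i k (by omega)
        (by simpa using hc)
      convert key using 2 <;> ring
    · obtain rfl : i = 1 := by simpa using hc
      simpa using h₁.trans hm₁
    · obtain ⟨k, rfl⟩ := Nat.exists_eq_add_of_le hlt.le
      have key := ih hF.left_mediant h₁ (by linarith)
        (by rw [hT.left hF]; nlinarith) (by rw [hT.left hF]; nlinarith) k j (by omega)
        (by simpa using hc)
      convert key using 2 <;> ring

lemma three_le_of_between (hT : IsMarkoff T) {q₁ p₁ q₂ p₂ : ℕ} (hF : IsFarey q₁ p₁ q₂ p₂)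
    (h₁ : 3 ≤ T q₁ p₁) (h₂ : 3 ≤ T q₂ p₂)
    (hm : T q₁ p₁ * T q₂ p₂ - 2 ≤ T (q₁ + q₂) (p₁ + p₂))
    {u v : ℕ} (huv : u.Coprime v) (hu₁ : q₁ * v ≤ u * p₁) (hu₂ : u * p₂ ≤ q₂ * v) :
    3 ≤ T u v := by
  obtain ⟨i, j, hij, rfl, rfl⟩ := hF.exists_coords huv hu₁ hu₂
  exact hT.three_le_combination _ hF h₁ h₂ (by nlinarith) (by nlinarith) i j le_rfl hij

lemma sin_mul_fan (hT : IsMarkoff T) {q₁ p₁ q₂ p₂ : ℕ} (hF : IsFarey q₁ p₁ q₂ p₂) {θ : ℝ}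
    (hθ : T (q₁ + q₂) (p₁ + p₂) = 2 * Real.cos θ) (j : ℕ) :
    IsFarey (q₁ + q₂) (p₁ + p₂) (j * (q₁ + q₂) + q₂) (j * (p₁ + p₂) + p₂) ∧
    Real.sin θ * T (j * (q₁ + q₂) + q₂) (j * (p₁ + p₂) + p₂) =
      Real.sin ((j + 1) * θ) * T q₂ p₂ - Real.sin (j * θ) * T q₁ p₁ ∧
    Real.sin θ * T ((j + 1) * (q₁ + q₂) + q₂) ((j + 1) * (p₁ + p₂) + p₂) =
      Real.sin ((j + 2) * θ) * T q₂ p₂ - Real.sin ((j + 1) * θ) * T q₁ p₁ := by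
  have hsin (a : ℝ) : Real.sin ((a + 2) * θ) =
      2 * Real.cos θ * Real.sin ((a + 1) * θ) - Real.sin (a * θ) := by
    have e₁ : (a + 2) * θ = (a + 1) * θ + θ := by ring
    have e₂ : a * θ = (a + 1) * θ - θ := by ring
    rw [e₁, e₂, Real.sin_add, Real.sin_sub]
    ring
  induction j with
  | zero =>
    refine ⟨by simpa using hF.mediant_right, by simp, ?_⟩
    have h := hT.right hF
    have h2 := hsin 0
    simp only [zero_add, zero_mul, Real.sin_zero, one_mul, sub_zero] at h2
    rw [hθ] at h
    simp only [zero_add, one_mul, Nat.cast_zero, h, h2]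
    ring
  | succ j ih =>
    obtain ⟨hFj, h₁, h₂⟩ := ih
    have hFj' : IsFarey (q₁ + q₂) (p₁ + p₂) ((j + 1) * (q₁ + q₂) + q₂)
        ((j + 1) * (p₁ + p₂) + p₂) := by
      convert hFj.left_mediant using 1 <;> ring
    refine ⟨hFj', ?_, ?_⟩
    · push_cast
      rw [h₂]
      ring_nf
    · have h := hT.left hFj
      have e (a b : ℕ) : a + (a + (j * a + b)) = (j + 1 + 1) * a + b := by ring
      have e' (a b : ℕ) : a + (j * a + b) = (j + 1) * a + b := by ring
      rw [e, e, e', e', hθ] at h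
      have s₁ := hsin (j + 1)
      rw [show (j : ℝ) + 1 + 1 = j + 2 by ring] at s₁
      push_cast
      rw [h, show (j : ℝ) + 1 + 1 = j + 2 by ring, s₁]
      linear_combination 2 * Real.cos θ * h₂ - h₁ + T q₁ p₁ * hsin j

lemma three_le_fan (hT : IsMarkoff T) {q₁ p₁ q₂ p₂ n : ℕ} (hF : IsFarey q₁ p₁ q₂ p₂)
    (hn : 2 ≤ n)
    (hθ : T (q₁ + q₂) (p₁ + p₂) = 2 * Real.cos (Real.pi / (2 * n)))
    (h₁ : |T q₁ p₁| ≤ 2) (h₂ : 3 + 2 / Real.sin (Real.pi / (2 * n)) ≤ T q₂ p₂)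
    {j : ℕ} (hj : j + 2 ≤ 2 * n) : 3 ≤ T (j * (q₁ + q₂) + q₂) (j * (p₁ + p₂) + p₂) := by
  have hn' : (2 : ℝ) ≤ n := by exact_mod_cast hn
  have hj' : (j : ℝ) + 2 ≤ 2 * n := by exact_mod_cast hj
  set θ := Real.pi / (2 * n) with hθ_def
  have hnθ : 2 * n * θ = Real.pi := by rw [hθ_def]; field_simp
  have hθ_pos : 0 < θ := by have := Real.pi_pos; positivity
  have hj0 : (0 : ℝ) ≤ j := j.cast_nonneg
  have hs : 0 < Real.sin θ := Real.sin_pos_of_pos_of_lt_pi hθ_pos (by nlinarith)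
  have hs' : Real.sin θ ≤ Real.sin ((j + 1) * θ) := by
    rcases le_total ((j + 1) * θ) (Real.pi / 2) with h | h
    · exact Real.sin_le_sin_of_le_of_le_pi_div_two (by nlinarith) h (by nlinarith)
    · rw [← Real.sin_pi_sub ((j + 1) * θ)]
      exact Real.sin_le_sin_of_le_of_le_pi_div_two (by nlinarith) (by linarith) (by nlinarith)
  obtain ⟨-, key, -⟩ := hT.sin_mul_fan hF hθ j
  have hb : Real.sin (j * θ) * T q₁ p₁ ≤ 2 := by
    refine (le_abs_self _).trans ?_
    rw [abs_mul]
    nlinarith [Real.abs_sin_le_one (j * θ), abs_nonneg (T q₁ p₁), abs_nonneg (Real.sin (j * θ))]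
  have h₃ : 3 * Real.sin θ + 2 ≤ Real.sin θ * T q₂ p₂ := by
    have := mul_le_mul_of_nonneg_left h₂ hs.le
    rw [mul_add, mul_div_cancel₀ _ hs.ne'] at this
    linarith
  have h₄ : 0 ≤ T q₂ p₂ := le_trans (by positivity) h₂
  have : Real.sin θ * 3 ≤ Real.sin θ * T (j * (q₁ + q₂) + q₂) (j * (p₁ + p₂) + p₂) := by
    rw [key]
    nlinarith
  exact le_of_mul_le_mul_left this hs

lemma three_le_of_mem_fan (hT : IsMarkoff T) {q₁ p₁ q₂ p₂ n : ℕ} (hF : IsFarey q₁ p₁ q₂ p₂)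
    (hn : 2 ≤ n)
    (hθ : T (q₁ + q₂) (p₁ + p₂) = 2 * Real.cos (Real.pi / (2 * n)))
    (h₁ : |T q₁ p₁| ≤ 2) (h₂ : 3 + 2 / Real.sin (Real.pi / (2 * n)) ≤ T q₂ p₂)
    {u v : ℕ} (huv : u.Coprime v) (hu : u * p₂ ≤ q₂ * v) (j : ℕ) (hj : j + 2 ≤ 2 * n)
    (hu' : (j * (q₁ + q₂) + q₂) * v ≤ u * (j * (p₁ + p₂) + p₂)) : 3 ≤ T u v := by
  have h₃ {i : ℕ} (hi : i + 2 ≤ 2 * n) := hT.three_le_fan hF hn hθ h₁ h₂ hi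
  have hfar (i : ℕ) := (hT.sin_mul_fan hF hθ i).1
  induction j with
  | zero =>
    obtain ⟨rfl, rfl⟩ := hF.eq_right huv (by simpa using hu') hu
    simpa using h₃ (i := 0) (by omega)
  | succ j ih =>
    rcases le_total ((j * (q₁ + q₂) + q₂) * v) (u * (j * (p₁ + p₂) + p₂)) with h | h
    · exact ih (by omega) h
    · have hF' : IsFarey ((j + 1) * (q₁ + q₂) + q₂) ((j + 1) * (p₁ + p₂) + p₂)
          (j * (q₁ + q₂) + q₂) (j * (p₁ + p₂) + p₂) := by
        convert (hfar j).mediant_right using 1 <;> ring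
      refine hT.three_le_of_between hF' (h₃ hj) (h₃ (by omega)) ?_ huv hu' h
      have e (a b : ℕ) : (j + 1) * a + b = a + (j * a + b) := by ring
      have hr := hT.right (hfar j)
      rw [e, e, hr, hθ]
      nlinarith [Real.cos_le_one (Real.pi / (2 * n))]

end IsMarkoff

lemma exists_first_eq {f : ℝ → ℝ} (hf : Continuous f) {α β v : ℝ} (hαβ : α ≤ β)
    (hα : v ≤ f α) (hβ : f β ≤ v) :
    ∃ γ ∈ Set.Icc α β, f γ = v ∧ ∀ x ∈ Set.Icc α γ, v ≤ f x := by
  have hne : (Set.Icc α β ∩ f ⁻¹' {v}).Nonempty := by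
    obtain ⟨x, hx, hxv⟩ := intermediate_value_Icc' hαβ hf.continuousOn ⟨hβ, hα⟩
    exact ⟨x, hx, hxv⟩
  have hcomp : IsCompact (Set.Icc α β ∩ f ⁻¹' {v}) :=
    isCompact_Icc.inter_right (isClosed_singleton.preimage hf)
  obtain ⟨γ, ⟨hγ, hγv⟩, hmin⟩ := hcomp.exists_isLeast hne
  refine ⟨γ, hγ, hγv, fun x hx => ?_⟩
  by_contra! hlt
  obtain ⟨y, hy, hyv⟩ := intermediate_value_Icc' hx.1 hf.continuousOn ⟨hlt.le, hα⟩
  have hle : γ ≤ y := hmin ⟨⟨hy.1, hy.2.trans (hx.2.trans hγ.2)⟩, hyv⟩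
  have hxγ : x = γ := le_antisymm hx.2 (hle.trans hy.2)
  rw [hxγ, show f γ = v from hγv] at hlt
  exact lt_irrefl _ hlt

lemma exists_last_eq {f : ℝ → ℝ} (hf : Continuous f) {α β v : ℝ} (hαβ : α ≤ β)
    (hα : v ≤ f α) (hβ : f β ≤ v) :
    ∃ γ ∈ Set.Icc α β, f γ = v ∧ ∀ x ∈ Set.Icc γ β, f x ≤ v := by
  obtain ⟨γ, hγ, hγv, h⟩ := exists_first_eq (f := fun x => -f (-x)) (v := -v)
    (hf.comp continuous_neg).neg (neg_le_neg hαβ) (by simpa using hβ) (by simpa using hα)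
  refine ⟨-γ, ⟨by linarith [hγ.2], by linarith [hγ.1]⟩, by simpa using hγv, fun x hx => ?_⟩
  simpa using h (-x) ⟨by linarith [hx.2], by linarith [hx.1]⟩

/-- Descent along the Stern–Brocot path from the edge `(q₁/p₁, q₂/p₂)` to the fraction
`(i q₁ + j q₂) / (i p₁ + j p₂)`, in a one-parameter family of Markoff maps: the parameter interval
is narrowed so that left endpoints keep absolute value at most `2` while right endpoints stay
large. -/
lemma exists_param_of_edge {c M : ℝ} (hc : |c| ≤ 2) (N : ℕ) :
    ∀ i j : ℕ, i + j ≤ N → i.Coprime j → 0 < i → 0 < j →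
    ∃ L : ℝ, 4 ≤ L ∧ ∀ T : ℝ → ℕ → ℕ → ℝ, (∀ x, IsMarkoff (T x)) →
      (∀ q p, Continuous fun x => T x q p) →
      ∀ q₁ p₁ q₂ p₂ : ℕ, IsFarey q₁ p₁ q₂ p₂ → ∀ α β : ℝ, α ≤ β →
      (∀ x ∈ Set.Icc α β, |T x q₁ p₁| ≤ 2 ∧ L ≤ T x q₂ p₂) →
      T α q₁ p₁ = 2 → T α q₂ p₂ ≤ T α (q₁ + q₂) (p₁ + p₂) →
      T β (q₁ + q₂) (p₁ + p₂) ≤ -2 →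
      ∃ x, ∃ Q₁ P₁ Q₂ P₂ : ℕ, x ∈ Set.Icc α β ∧ IsFarey Q₁ P₁ Q₂ P₂ ∧
        i * q₁ + j * q₂ = Q₁ + Q₂ ∧ i * p₁ + j * p₂ = P₁ + P₂ ∧
        T x (Q₁ + Q₂) (P₁ + P₂) = c ∧ |T x Q₁ P₁| ≤ 2 ∧ M ≤ T x Q₂ P₂ ∧
        ∀ u v : ℕ, u.Coprime v → Q₂ * v ≤ u * P₂ → u * p₂ ≤ q₂ * v → 3 ≤ T x u v := by
  induction N with
  | zero => intro i j hij _ hi; omega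
  | succ N ih =>
    intro i j hij hcop hi hj
    obtain ⟨hc₁, hc₂⟩ := abs_le.mp hc
    rcases lt_trichotomy i j with hlt | rfl | hlt
    · obtain ⟨k, rfl⟩ := Nat.exists_eq_add_of_le hlt.le
      obtain ⟨L, hL, key⟩ := ih i k (by omega) (by simpa using hcop) hi (by omega)
      refine ⟨L, hL, fun T hT hcont q₁ p₁ q₂ p₂ hF α β hαβ hI hα hα' hβ => ?_⟩
      have hIα := hI α ⟨le_rfl, hαβ⟩
      obtain ⟨β', hβ', hβ'v, hge⟩ := exists_first_eq (hcont (q₁ + q₂) (p₁ + p₂)) hαβ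
        (v := -2) (by linarith) hβ
      obtain ⟨α', hα', hα'v, hle⟩ := exists_last_eq (hcont (q₁ + q₂) (p₁ + p₂)) hβ'.1
        (v := 2) (by linarith) (by linarith)
      have hsub {x : ℝ} (hx : x ∈ Set.Icc α' β') : x ∈ Set.Icc α β :=
        ⟨hα'.1.trans hx.1, hx.2.trans hβ'.2⟩
      obtain ⟨x, Q₁, P₁, Q₂, P₂, hx, hQ, e₁, e₂, hxc, hx₁, hx₂, hx₃⟩ :=
        key T hT hcont _ _ _ _ hF.mediant_right α' β' hα'.2
          (fun x hx => ⟨abs_le.mpr ⟨hge x ⟨hα'.1.trans hx.1, hx.2⟩, hle x hx⟩,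
            (hI x (hsub hx)).2⟩) hα'v
          (by
            have h := hI α' (hsub ⟨le_rfl, hα'.2⟩)
            rw [(hT α').right hF, hα'v]
            linarith [(abs_le.mp h.1).2])
          (by
            have h := hI β' (hsub ⟨hα'.2, le_rfl⟩)
            rw [(hT β').right hF, hβ'v]
            linarith [(abs_le.mp h.1).1])
      refine ⟨x, Q₁, P₁, Q₂, P₂, hsub hx, hQ, ?_, ?_, hxc, hx₁, hx₂, hx₃⟩
      · rw [← e₁]; ring
      · rw [← e₂]; ring
    · obtain rfl : i = 1 := by simpa using hcop
      refine ⟨max 4 M, le_max_left _ _, fun T hT hcont q₁ p₁ q₂ p₂ hF α β hαβ hI hα hα' hβ => ?_⟩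
      have hIα := (le_max_left _ _).trans (hI α ⟨le_rfl, hαβ⟩).2
      obtain ⟨x, hx, hxc, -⟩ := exists_first_eq (hcont (q₁ + q₂) (p₁ + p₂)) hαβ (v := c)
        (by linarith) (by linarith)
      have hIx := hI x hx
      refine ⟨x, q₁, p₁, q₂, p₂, hx, hF, by ring, by ring, hxc, hIx.1,
        (le_max_right _ _).trans hIx.2, fun u v huv hu₁ hu₂ => ?_⟩
      obtain ⟨rfl, rfl⟩ := hF.eq_right huv hu₁ hu₂
      linarith [le_max_left 4 M]
    · obtain ⟨k, rfl⟩ := Nat.exists_eq_add_of_le hlt.le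
      obtain ⟨L, hL, key⟩ := ih k j (by omega) (by simpa using hcop) (by omega) hj
      refine ⟨2 * L + 2, by linarith,
        fun T hT hcont q₁ p₁ q₂ p₂ hF α β hαβ hI hα hα' hβ => ?_⟩
      have hIα := hI α ⟨le_rfl, hαβ⟩
      obtain ⟨β', hβ', hβ'v, hge⟩ := exists_first_eq (hcont (q₁ + q₂) (p₁ + p₂)) hαβ
        (v := L) (by linarith) (by linarith)
      have hsub {x : ℝ} (hx : x ∈ Set.Icc α β') : x ∈ Set.Icc α β := ⟨hx.1, hx.2.trans hβ'.2⟩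
      obtain ⟨x, Q₁, P₁, Q₂, P₂, hx, hQ, e₁, e₂, hxc, hx₁, hx₂, hx₃⟩ :=
        key T hT hcont _ _ _ _ hF.left_mediant α β' hβ'.1
          (fun x hx => ⟨(hI x (hsub hx)).1, hge x hx⟩) hα
          (by
            rw [(hT α).left hF, hα]
            linarith)
          (by
            have h := hI β' (hsub ⟨hβ'.1, le_rfl⟩)
            rw [(hT β').left hF, hβ'v]
            nlinarith [(abs_le.mp h.1).2])
      refine ⟨x, Q₁, P₁, Q₂, P₂, hsub hx, hQ, ?_, ?_, hxc, hx₁, hx₂, fun u v huv hu₁ hu₂ => ?_⟩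
      · rw [← e₁]; ring
      · rw [← e₂]; ring
      · rcases le_total (u * (p₁ + p₂)) ((q₁ + q₂) * v) with h | h
        · exact hx₃ u v huv hu₁ h
        · have hIx := hI x (hsub hx)
          refine (hT x).three_le_of_between hF.mediant_right (by linarith [hge x hx])
            (by linarith) ?_ huv h hu₂
          rw [(hT x).right hF]
          nlinarith [(abs_le.mp hIx.1).2]

section Matrices

open Matrix

variable (x y : ℝ)

local notation "Mat" => Matrix (Fin 2) (Fin 2) ℝ

lemma trace_mul_mul_left {A : Mat} (hA : A.det = 1) (B : Mat) :
    (A * (A * B)).trace = A.trace * (A * B).trace - B.trace := by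
  rw [det_fin_two] at hA
  simp only [trace_fin_two, mul_apply, Fin.sum_univ_two]
  linear_combination (-(B 0 0 + B 1 1)) * hA

lemma trace_mul_mul_right {B : Mat} (hB : B.det = 1) (A : Mat) :
    (A * B * B).trace = B.trace * (A * B).trace - A.trace := by
  rw [det_fin_two] at hB
  simp only [trace_fin_two, mul_apply, Fin.sum_univ_two]
  linear_combination (-(A 0 0 + A 1 1)) * hB

lemma mul_self_eq {A : Mat} (hA : A.det = 1) : A * A = A.trace • A - 1 := by
  rw [det_fin_two] at hA
  ext i j
  fin_cases i <;> fin_cases j <;>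
    simp [mul_apply, Fin.sum_univ_two, trace_fin_two] <;> linarith

/-- For `σ = ±1`, the roots of the quadratic `z² + x z + (1 - y²/4)`. -/
noncomputable def offDiag (σ : ℝ) : ℝ := (-x + σ * √(x ^ 2 + y ^ 2 - 4)) / 2

/-- A reflection `K` of the hyperbolic plane. -/
noncomputable def reflK : Mat := !![y / 2, offDiag x y 1; offDiag x y (-1), -(y / 2)]

/-- The rotation of order two in the Klein four-group `{1, f, g, f g}` of isometries. -/
def rotF : Mat := !![0, 1; -1, 0]

/-- A reflection in the Klein four-group `{1, f, g, f g}` of isometries. -/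
def reflG : Mat := !![1, 0; 0, -1]

lemma offDiag_mul (h : 4 ≤ x ^ 2 + y ^ 2) :
    offDiag x y 1 * offDiag x y (-1) = 1 - y ^ 2 / 4 := by
  have hs := Real.mul_self_sqrt (show 0 ≤ x ^ 2 + y ^ 2 - 4 by linarith)
  unfold offDiag
  linear_combination (-1 / 4 : ℝ) * hs

lemma offDiag_add : offDiag x y 1 + offDiag x y (-1) = -x := by
  unfold offDiag
  ring

lemma reflK_mul_self (h : 4 ≤ x ^ 2 + y ^ 2) : reflK x y * reflK x y = 1 := by
  have hm := offDiag_mul x y h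
  ext i j
  fin_cases i <;> fin_cases j <;> simp [reflK, mul_apply, Fin.sum_univ_two] <;> linarith

lemma rotF_mul_self : rotF * rotF = -1 := by
  ext i j
  fin_cases i <;> fin_cases j <;> simp [rotF, mul_apply, Fin.sum_univ_two]

lemma reflG_mul_self : reflG * reflG = 1 := by
  ext i j
  fin_cases i <;> fin_cases j <;> simp [reflG, mul_apply, Fin.sum_univ_two]

/-- The `i`-th letter of the Christoffel word of slope `q/p`, evaluated at the matrices
`K f g` and `K g`: it is `K g` if `⌊i q/p⌋` jumps and `K f g` otherwise. -/
noncomputable def letter (q p i : ℕ) : Mat :=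
  if (i + 1) * q / p = i * q / p then reflK x y * (rotF * reflG) else reflK x y * reflG

/-- The value of the Christoffel word of slope `q/p`. -/
noncomputable def christoffel (q p : ℕ) : Mat := ((List.range p).map (letter x y q p)).prod

lemma christoffel_add {q₁ p₁ q₂ p₂ : ℕ} (hF : IsFarey q₁ p₁ q₂ p₂) :
    christoffel x y (q₁ + q₂) (p₁ + p₂) = christoffel x y q₁ p₁ * christoffel x y q₂ p₂ := by
  have hd := hF.det
  have hp₁ := hF.pos_left
  have hp₂ := hF.pos
  have left (i : ℕ) (hi : i ≤ p₁) : i * (q₁ + q₂) / (p₁ + p₂) = i * q₁ / p₁ := by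
    set u := i * q₁ / p₁
    have hu₁ : u * p₁ ≤ i * q₁ := Nat.div_mul_le_self _ _
    have hu₂ : i * q₁ + 1 ≤ (u + 1) * p₁ := Nat.lt_mul_of_div_lt (Nat.lt_succ_self _) hp₁
    have hid : i * (q₂ * p₁) = i * (q₁ * p₂ + 1) := by rw [hd]
    refine Nat.div_eq_of_lt_le ?_ ?_
    · refine le_of_mul_le_mul_right ?_ hp₁
      have := Nat.mul_le_mul_right (p₁ + p₂) hu₁
      nlinarith
    · refine lt_of_mul_lt_mul_right ?_ hp₁.le
      have := Nat.mul_le_mul_right (p₁ + p₂) hu₂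
      nlinarith
  have right (j : ℕ) (hj : j ≤ p₂) :
      (p₁ + j) * (q₁ + q₂) / (p₁ + p₂) = q₁ + j * q₂ / p₂ := by
    set v := j * q₂ / p₂
    have hv₁ : v * p₂ ≤ j * q₂ := Nat.div_mul_le_self _ _
    have hv₂ : j * q₂ + 1 ≤ (v + 1) * p₂ := Nat.lt_mul_of_div_lt (Nat.lt_succ_self _) hp₂
    have hjd : j * (q₂ * p₁) = j * (q₁ * p₂ + 1) := by rw [hd]
    refine Nat.div_eq_of_lt_le ?_ ?_
    · refine le_of_mul_le_mul_right ?_ hp₂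
      have := Nat.mul_le_mul_right (p₁ + p₂) hv₁
      nlinarith
    · refine lt_of_mul_lt_mul_right ?_ hp₂.le
      have := Nat.mul_le_mul_right (p₁ + p₂) hv₂
      nlinarith
  unfold christoffel
  rw [List.range_add, List.map_append, List.prod_append, List.map_map]
  congr 2
  · refine List.map_congr_left fun i hi => ?_
    have hi' := List.mem_range.mp hi
    simp only [letter, left i hi'.le, left (i + 1) hi']
  · refine List.map_congr_left fun j hj => ?_
    have hj' := List.mem_range.mp hj
    simp only [letter, Function.comp, right j hj'.le, add_assoc, right (j + 1) hj',
      Nat.add_left_cancel_iff]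

/-- The trace of the Christoffel word of slope `q/p`. -/
noncomputable def chTrace (q p : ℕ) : ℝ := (christoffel x y q p).trace

lemma christoffel_zero_one : christoffel x y 0 1 = reflK x y * (rotF * reflG) := by
  simp [christoffel, letter]

lemma christoffel_one_one : christoffel x y 1 1 = reflK x y * reflG := by
  simp [christoffel, letter]

lemma isFarey_zero_one : IsFarey 0 1 1 1 := ⟨rfl, one_pos, zero_le_one, le_rfl⟩

lemma chTrace_zero_one : chTrace x y 0 1 = x := by
  rw [chTrace, christoffel_zero_one]
  simp [reflK, rotF, reflG, trace_fin_two]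
  linarith [offDiag_add x y]

lemma chTrace_one_one : chTrace x y 1 1 = y := by
  rw [chTrace, christoffel_one_one]
  simp [reflK, reflG, trace_fin_two]

lemma chTrace_one_two : chTrace x y 1 2 = x * y := by
  have h := christoffel_add x y isFarey_zero_one
  norm_num at h
  rw [chTrace, h, christoffel_zero_one, christoffel_one_one]
  simp [reflK, rotF, reflG, trace_fin_two]
  linear_combination (-y) * offDiag_add x y

variable {x y}

lemma det_christoffel (h : 4 ≤ x ^ 2 + y ^ 2) (q p : ℕ) : (christoffel x y q p).det = 1 := by
  have hm := offDiag_mul x y h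
  have hl (i : ℕ) : (letter x y q p i).det = 1 := by
    unfold letter
    split_ifs <;> simp [reflK, rotF, reflG, det_fin_two] <;> linarith
  have (l : List ℕ) : ((l.map (letter x y q p)).prod).det = 1 := by
    induction l with
    | nil => simp
    | cons a l ih => rw [List.map_cons, List.prod_cons, det_mul, hl, ih, one_mul]
  exact this _

lemma isMarkoff_chTrace (h : 4 ≤ x ^ 2 + y ^ 2) : IsMarkoff (chTrace x y) where
  base := by rw [chTrace_one_two, chTrace_zero_one, chTrace_one_one]
  left hF := by
    simp only [chTrace, christoffel_add x y hF.left_mediant, christoffel_add x y hF]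
    exact trace_mul_mul_left (det_christoffel h _ _) _
  right hF := by
    simp only [chTrace, christoffel_add x y hF.mediant_right, christoffel_add x y hF]
    exact trace_mul_mul_right (det_christoffel h _ _) _

lemma IsMarkoff.reflect {T : ℕ → ℕ → ℝ} (hT : IsMarkoff T) :
    IsMarkoff fun q p => T (p - q) p where
  base := by simpa [mul_comm] using hT.base
  left {q₁ p₁ q₂ p₂} hF := by
    obtain ⟨a₁, rfl⟩ := Nat.exists_eq_add_of_le hF.le_left
    obtain ⟨a₂, rfl⟩ := Nat.exists_eq_add_of_le hF.le_right
    have hF' : IsFarey a₂ (q₂ + a₂) a₁ (q₁ + a₁) :=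
      ⟨by have := hF.det; nlinarith, hF.pos_left, by omega, by omega⟩
    have e₁ : q₁ + a₁ + (q₁ + a₁ + (q₂ + a₂)) - (q₁ + (q₁ + q₂)) = a₂ + a₁ + a₁ := by omega
    have e₂ : q₁ + a₁ + (q₁ + a₁ + (q₂ + a₂)) = q₂ + a₂ + (q₁ + a₁) + (q₁ + a₁) := by omega
    have e₃ : q₁ + a₁ + (q₂ + a₂) - (q₁ + q₂) = a₂ + a₁ := by omega
    have e₄ : q₁ + a₁ + (q₂ + a₂) = q₂ + a₂ + (q₁ + a₁) := by omega
    rw [e₁, e₂, e₃, e₄, Nat.add_sub_cancel_left, Nat.add_sub_cancel_left]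
    exact hT.right hF'
  right {q₁ p₁ q₂ p₂} hF := by
    obtain ⟨a₁, rfl⟩ := Nat.exists_eq_add_of_le hF.le_left
    obtain ⟨a₂, rfl⟩ := Nat.exists_eq_add_of_le hF.le_right
    have hF' : IsFarey a₂ (q₂ + a₂) a₁ (q₁ + a₁) :=
      ⟨by have := hF.det; nlinarith, hF.pos_left, by omega, by omega⟩
    have e₁ : q₁ + a₁ + (q₂ + a₂) + (q₂ + a₂) - (q₁ + q₂ + q₂) = a₂ + (a₂ + a₁) := by omega
    have e₂ : q₁ + a₁ + (q₂ + a₂) + (q₂ + a₂) = q₂ + a₂ + (q₂ + a₂ + (q₁ + a₁)) := by omega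
    have e₃ : q₁ + a₁ + (q₂ + a₂) - (q₁ + q₂) = a₂ + a₁ := by omega
    have e₄ : q₁ + a₁ + (q₂ + a₂) = q₂ + a₂ + (q₁ + a₁) := by omega
    rw [e₁, e₂, e₃, e₄, Nat.add_sub_cancel_left, Nat.add_sub_cancel_left]
    exact hT.left hF'

lemma continuous_chTrace (q p : ℕ) : Continuous fun z : ℝ × ℝ => chTrace z.1 z.2 q p := by
  have hK : Continuous fun z : ℝ × ℝ => reflK z.1 z.2 := by
    refine continuous_matrix fun i j => ?_
    fin_cases i <;> fin_cases j <;> simp [reflK, offDiag] <;> fun_prop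
  refine Continuous.matrix_trace ?_
  unfold christoffel
  refine continuous_list_prod _ fun i _ => ?_
  unfold letter
  split_ifs
  · exact hK.mul continuous_const
  · exact hK.mul continuous_const

lemma sin_smul_pow {A : Mat} (hA : A.det = 1) {θ : ℝ} (hθ : A.trace = 2 * Real.cos θ) (k : ℕ) :
    Real.sin θ • A ^ k = Real.sin (k * θ) • A - Real.sin ((k - 1) * θ) • (1 : Mat) := by
  induction k with
  | zero => simp
  | succ k ih =>
    have hs : Real.sin ((k + 1) * θ) =
        2 * Real.cos θ * Real.sin (k * θ) - Real.sin ((k - 1) * θ) := by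
      rw [add_mul, sub_mul, one_mul, Real.sin_add, Real.sin_sub]
      ring
    rw [pow_succ, ← smul_mul_assoc, ih, sub_mul, smul_mul_assoc, mul_self_eq hA, hθ]
    push_cast
    rw [hs, add_sub_cancel_right, smul_mul_assoc, one_mul]
    module

lemma pow_eq_neg_one {A : Mat} (hA : A.det = 1) {n : ℕ} (hn : 2 ≤ n)
    (hθ : A.trace = 2 * Real.cos (Real.pi / (2 * n))) : A ^ (2 * n) = -1 := by
  have hn' : (2 : ℝ) ≤ n := by exact_mod_cast hn
  have h := sin_smul_pow hA hθ (2 * n)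
  set θ := Real.pi / (2 * n) with hθ_def
  have hnθ : 2 * n * θ = Real.pi := by rw [hθ_def]; field_simp
  have hθ_pos : 0 < θ := by have := Real.pi_pos; positivity
  have hs : Real.sin θ ≠ 0 := (Real.sin_pos_of_pos_of_lt_pi hθ_pos (by nlinarith)).ne'
  push_cast at h
  rw [sub_mul, hnθ, one_mul, Real.sin_pi, zero_smul, zero_sub, Real.sin_pi_sub, ← smul_neg] at h
  exact smul_right_injective Mat hs h

lemma three_le_trace_pow {A : Mat} (hA : A.det = 1) (ht : 3 ≤ A.trace) (k : ℕ) :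
    (A ^ k).trace ≤ (A ^ (k + 1)).trace ∧ 3 ≤ (A ^ (k + 1)).trace := by
  induction k with
  | zero =>
    rw [zero_add, pow_zero, pow_one, trace_one, Fintype.card_fin]
    constructor <;> norm_num <;> linarith
  | succ k ih =>
    have h : (A ^ (k + 1 + 1)).trace = A.trace * (A ^ (k + 1)).trace - (A ^ k).trace := by
      rw [pow_succ, pow_succ, mul_assoc, mul_self_eq hA, mul_sub, mul_smul_comm, ← pow_succ,
        mul_one, trace_sub, trace_smul, smul_eq_mul]
    constructor <;> nlinarith

lemma christoffel_mul_self (q p : ℕ) (hp : 0 < p) :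
    ((List.range (2 * p)).map (letter x y q p)).prod = christoffel x y q p ^ 2 := by
  rw [two_mul, List.range_add, List.map_append, List.prod_append, List.map_map, sq]
  unfold christoffel
  congr 2
  refine List.map_congr_left fun i _ => ?_
  have h (j : ℕ) : (p + j) * q / p = q + j * q / p := by
    rw [add_mul, Nat.mul_add_div hp]
  simp only [letter, Function.comp, add_assoc, h, Nat.add_left_cancel_iff]

/-- The image of the generator `a`. -/
noncomputable def imageA (h : 4 ≤ x ^ 2 + y ^ 2) : Matˣ where
  val := reflK x y * rotF
  inv := -(rotF * reflK x y)
  val_inv := by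
    rw [mul_neg, mul_assoc, ← mul_assoc rotF, rotF_mul_self, neg_one_mul, mul_neg, neg_neg,
      reflK_mul_self x y h]
  inv_val := by
    rw [neg_mul, mul_assoc, ← mul_assoc (reflK x y), reflK_mul_self x y h, one_mul, rotF_mul_self,
      neg_neg]

/-- The reflection `g` as a unit. -/
def unitG : Matˣ := ⟨reflG, reflG, reflG_mul_self, reflG_mul_self⟩

/-- The representation sending `a` to `K f` and `b` to `g (K f) g`. -/
noncomputable def rep (h : 4 ≤ x ^ 2 + y ^ 2) : F →* Matˣ :=
  FreeGroup.lift ![imageA h, unitG * imageA h * unitG]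

/-- The element of the Klein four-group relating prefixes of `u_s` to prefixes of the
Christoffel word. -/
def tail (i e : ℕ) : Mat :=
  if Even i then (if Even e then 1 else rotF) else (if Even e then reflG else rotF * reflG)

lemma val_rep_gen_pow (h : 4 ≤ x ^ 2 + y ^ 2) (i e : ℕ) :
    ((rep h (gen i ^ ((-1 : ℤ) ^ e)) : Matˣ) : Mat) =
      if Even i then (if Even e then reflK x y * rotF else -(rotF * reflK x y))
      else (if Even e then reflG * (reflK x y * rotF) * reflG
        else reflG * -(rotF * reflK x y) * reflG) := by
  have hg : rep h (gen i) =
      if Even i then imageA h else unitG * imageA h * unitG := by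
    rcases Nat.even_or_odd i with hi | hi
    · rw [if_pos hi]
      simp [rep, gen, Nat.even_iff.mp hi]
    · rw [if_neg (Nat.not_even_iff_odd.mpr hi)]
      simp [rep, gen, Nat.odd_iff.mp hi]
  rw [map_zpow, hg]
  rcases Nat.even_or_odd e with he | he
  · simp only [he.neg_one_pow, zpow_one, if_pos he]
    split_ifs <;> rfl
  · simp only [he.neg_one_pow, _root_.zpow_neg, zpow_one, if_neg (Nat.not_even_iff_odd.mpr he)]
    split_ifs
    · rfl
    · simp only [_root_.mul_inv_rev, ← mul_assoc]
      rfl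

lemma tail_mul (i e : ℕ) (h : 4 ≤ x ^ 2 + y ^ 2) :
    (tail i e * ((rep h (gen i ^ ((-1 : ℤ) ^ e)) : Matˣ) : Mat) =
        reflK x y * (rotF * reflG) * tail (i + 1) e ∨
      tail i e * ((rep h (gen i ^ ((-1 : ℤ) ^ e)) : Matˣ) : Mat) =
        -(reflK x y * (rotF * reflG) * tail (i + 1) e)) ∧
    (tail i e * ((rep h (gen i ^ ((-1 : ℤ) ^ e)) : Matˣ) : Mat) =
        reflK x y * reflG * tail (i + 1) (e + 1) ∨
      tail i e * ((rep h (gen i ^ ((-1 : ℤ) ^ e)) : Matˣ) : Mat) =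
        -(reflK x y * reflG * tail (i + 1) (e + 1))) := by
  have sign (A B : Mat) (hs : (A 0 0 = B 0 0 ∧ A 0 1 = B 0 1 ∧ A 1 0 = B 1 0 ∧ A 1 1 = B 1 1) ∨
      (A 0 0 = -B 0 0 ∧ A 0 1 = -B 0 1 ∧ A 1 0 = -B 1 0 ∧ A 1 1 = -B 1 1)) :
      A = B ∨ A = -B := by
    rcases hs with ⟨h₁, h₂, h₃, h₄⟩ | ⟨h₁, h₂, h₃, h₄⟩
    · left
      ext i j
      fin_cases i <;> fin_cases j <;> assumption
    · right
      ext i j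
      fin_cases i <;> fin_cases j <;> assumption
  rw [val_rep_gen_pow]
  rcases Nat.even_or_odd i with hi | hi <;> rcases Nat.even_or_odd e with he | he <;>
    simp only [tail, Nat.even_add_one, hi, he, Nat.not_even_iff_odd.mpr, not_true, not_false_iff,
      if_true, if_false] <;>
    constructor <;> apply sign <;> simp [reflK, rotF, reflG, mul_apply, Fin.sum_univ_two]

lemma rep_prod_range (h : 4 ≤ x ^ 2 + y ^ 2) {q p : ℕ} (hp : 0 < p) (hqp : q ≤ p) (j : ℕ) :
    ((rep h ((List.range j).map fun i => gen i ^ ((-1 : ℤ) ^ (i * q / p))).prod : Matˣ) : Mat) =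
        ((List.range j).map (letter x y q p)).prod * tail j (j * q / p) ∨
      ((rep h ((List.range j).map fun i => gen i ^ ((-1 : ℤ) ^ (i * q / p))).prod : Matˣ) : Mat) =
        -(((List.range j).map (letter x y q p)).prod * tail j (j * q / p)) := by
  induction j with
  | zero => simp [tail]
  | succ j ih =>
    have hl : tail j (j * q / p) *
          ((rep h (gen j ^ ((-1 : ℤ) ^ (j * q / p))) : Matˣ) : Mat) =
            letter x y q p j * tail (j + 1) ((j + 1) * q / p) ∨
        tail j (j * q / p) * ((rep h (gen j ^ ((-1 : ℤ) ^ (j * q / p))) : Matˣ) : Mat) =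
            -(letter x y q p j * tail (j + 1) ((j + 1) * q / p)) := by
      unfold letter
      split_ifs with hj
      · rw [hj]
        exact (tail_mul j _ h).1
      · have hj' : (j + 1) * q / p = j * q / p + 1 := by
          refine le_antisymm ?_ (lt_of_le_of_ne' (Nat.div_le_div_right (by nlinarith)) hj)
          rw [← Nat.add_div_right _ hp]
          exact Nat.div_le_div_right (by nlinarith)
        rw [hj']
        exact (tail_mul j _ h).2
    simp only [List.range_succ, List.map_append, List.map_cons, List.map_nil, List.prod_append,
      List.prod_cons, List.prod_nil, mul_one, map_mul, Units.val_mul]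
    rcases ih with ih | ih <;> rcases hl with hl | hl <;> rw [ih] <;>
      simp only [neg_mul, mul_assoc, hl, mul_neg, neg_neg] <;> tauto

lemma uWord_div {q p : ℕ} (hp : 0 < p) (hqp : q.Coprime p) :
    uWord (q / p : ℚ) =
      ((List.range (2 * p)).map fun i => gen i ^ ((-1 : ℤ) ^ (i * q / p))).prod := by
  have hden : ((q : ℚ) / p).den = p := by
    have := Rat.den_div_eq_of_coprime (a := q) (b := p) (by exact_mod_cast hp) (by simpa using hqp)
    rwa [Int.cast_natCast, Int.cast_natCast, Nat.cast_inj] at this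
  have hfloor (i : ℕ) : ⌊(i : ℚ) * (q / p)⌋.toNat = i * q / p := by
    have : (i : ℚ) * (q / p) = ((i * q : ℕ) : ℚ) / (p : ℕ) := by push_cast; ring
    rw [this, Rat.floor_natCast_div_natCast]
    rfl
  unfold uWord
  simp only [hden, hfloor]

lemma rep_uWord (h : 4 ≤ x ^ 2 + y ^ 2) {q p : ℕ} (hp : 0 < p) (hle : q ≤ p)
    (hqp : q.Coprime p) :
    ((rep h (uWord (q / p : ℚ)) : Matˣ) : Mat) = christoffel x y q p ^ 2 ∨
      ((rep h (uWord (q / p : ℚ)) : Matˣ) : Mat) = -christoffel x y q p ^ 2 := by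
  have ht : tail (2 * p) (2 * p * q / p) = 1 := by
    rw [mul_right_comm, Nat.mul_div_cancel _ hp]
    simp [tail]
  have := rep_prod_range h hp hle (2 * p)
  rwa [← uWord_div hp hqp, christoffel_mul_self q p hp, ht, mul_one] at this

/-- The central subgroup `{1, -1}`. -/
def signs : Subgroup Matˣ where
  carrier := {u | u = 1 ∨ u = -1}
  one_mem' := Or.inl rfl
  mul_mem' := by
    rintro u v (rfl | rfl) (rfl | rfl) <;> simp
  inv_mem' := by
    rintro u (rfl | rfl) <;> simp

instance : signs.Normal where
  conj_mem := by
    rintro u (rfl | rfl) v <;> simp [signs]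

lemma mem_signs_of_pow (u : Matˣ) {A : Mat} (h : (u : Mat) = A ∨ (u : Mat) = -A) (n : ℕ) :
    u ^ n ∈ signs ↔ A ^ n = 1 ∨ A ^ n = -1 := by
  have hs (v : Matˣ) : v ∈ signs ↔ (v : Mat) = 1 ∨ (v : Mat) = -1 := by
    change v = 1 ∨ v = -1 ↔ _
    simp only [Units.ext_iff, Units.val_one, Units.val_neg]
  rw [hs, Units.val_pow_eq_pow_val]
  rcases h with h | h <;> rw [h]
  rcases n.even_or_odd with hn | hn
  · rw [hn.neg_pow]
  · rw [hn.neg_pow, neg_eq_iff_eq_neg, neg_inj, or_comm]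

/-- If the trace of the Christoffel word of slope `q/p` is `2 cos (π / 2n)` and that of the one of
slope `v/w` is at least `3`, then `u_{v/w}` has infinite order in `⟨a, b | u_{q/p}^n⟩`. -/
lemma pow_notMem_heckN (h : 4 ≤ x ^ 2 + y ^ 2) {q p v w n : ℕ} (hp : 0 < p) (hle : q ≤ p)
    (hqp : q.Coprime p) (hw : 0 < w) (hvw : v ≤ w) (hvw' : v.Coprime w) (hn : 2 ≤ n)
    (hq : chTrace x y q p = 2 * Real.cos (Real.pi / (2 * n))) (hv : 3 ≤ chTrace x y v w)
    {t : ℕ} (ht : 1 ≤ t) : uWord (v / w : ℚ) ^ t ∉ heckN (q / p : ℚ) n := by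
  intro hmem
  have hle' : heckN (q / p : ℚ) n ≤ signs.comap (rep h) := by
    refine Subgroup.normalClosure_le_normal ?_
    rintro _ rfl
    rw [SetLike.mem_coe, Subgroup.mem_comap, map_pow, mem_signs_of_pow _ (rep_uWord h hp hle hqp),
      ← pow_mul]
    exact Or.inr (pow_eq_neg_one (det_christoffel h q p) hn hq)
  have hs := hle' hmem
  rw [Subgroup.mem_comap, map_pow, mem_signs_of_pow _ (rep_uWord h hw hvw hvw'), ← pow_mul] at hs
  obtain ⟨k, hk⟩ : ∃ k, 2 * t = k + 1 := ⟨2 * t - 1, by omega⟩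
  have h3 := (three_le_trace_pow (det_christoffel h v w) hv k).2
  rw [← hk] at h3
  rcases hs with hs | hs <;> rw [hs] at h3 <;>
    simp only [trace_neg, trace_one, Fintype.card_fin] at h3 <;> norm_num at h3

end Matrices

lemma IsFarey.pos_right {q₁ p₁ q₂ p₂ : ℕ} (hF : IsFarey q₁ p₁ q₂ p₂) : 0 < q₂ := by
  have hd := hF.det
  rcases Nat.eq_zero_or_pos q₂ with rfl | h
  · simp at hd
  · exact h

lemma IsFarey.add_lt_add {q₁ p₁ q₂ p₂ : ℕ} (hF : IsFarey q₁ p₁ q₂ p₂) : q₁ + q₂ < p₁ + p₂ := by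
  have hd := hF.det
  have h₁ := hF.le_left
  have h₂ := hF.le_right
  refine lt_of_le_of_ne (add_le_add h₁ h₂) fun h => ?_
  obtain rfl : q₁ = p₁ := by omega
  obtain rfl : q₂ = p₂ := by omega
  rw [mul_comm] at hd
  omega

lemma IsFarey.coprime_add {q₁ p₁ q₂ p₂ : ℕ} (hF : IsFarey q₁ p₁ q₂ p₂) :
    (q₁ + q₂).Coprime (p₁ + p₂) := by
  have hd := hF.det
  rw [← Nat.isCoprime_iff_coprime]
  refine ⟨-p₂, q₂, ?_⟩
  zify at hd
  push_cast
  linear_combination hd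

/-- A continuous one-parameter family of Markoff maps with boundary values `x` and `y` contains a
map which takes the value `2 cos (π / 2n)` at a given fraction and is at least `3` on all
sufficiently larger fractions. -/
lemma exists_param {T : ℝ → ℝ → ℕ → ℕ → ℝ} (hM : ∀ y x, 2 ≤ y → IsMarkoff (T y x))
    (hT : ∀ y q p, Continuous fun x => T y x q p) (h₀ : ∀ y x, T y x 0 1 = x)
    (h₁ : ∀ y x, T y x 1 1 = y) (h₂ : ∀ y x, T y x 1 2 = x * y) {q₁ p₁ q₂ p₂ n : ℕ}
    (hF : IsFarey q₁ p₁ q₂ p₂) (hn : 2 ≤ n) :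
    ∃ y x, 2 ≤ y ∧ T y x (q₁ + q₂) (p₁ + p₂) = 2 * Real.cos (Real.pi / (2 * n)) ∧
      ∀ u v : ℕ, u.Coprime v → u ≤ v →
        ((2 * n - 2) * (q₁ + q₂) + q₂) * v ≤ u * ((2 * n - 2) * (p₁ + p₂) + p₂) →
          3 ≤ T y x u v := by
  have hc : |2 * Real.cos (Real.pi / (2 * n))| ≤ 2 := by
    rw [abs_mul, abs_two]
    linarith [Real.abs_cos_le_one (Real.pi / (2 * n))]
  have hlt := hF.add_lt_add
  have hq : 0 < q₁ + q₂ := by have := hF.pos_right; omega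
  have hcop : (p₁ + p₂ - (q₁ + q₂)).Coprime (q₁ + q₂) :=
    (Nat.coprime_sub_self_left hlt.le).mpr hF.coprime_add.symm
  obtain ⟨L, hL, H⟩ := exists_param_of_edge (M := 3 + 2 / Real.sin (Real.pi / (2 * n))) hc _ _ _
    le_rfl hcop (Nat.sub_pos_of_lt hlt) hq
  obtain ⟨x, Q₁, P₁, Q₂, P₂, -, hF', hQ, hP, hθ, hb₁, hb₂, hle⟩ :=
    H (fun x => T L (-x)) (fun x => hM L _ (by linarith)) (fun q p => (hT L q p).comp continuous_neg)
      0 1 1 1 isFarey_zero_one (-2) 2 (by norm_num)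
      (fun x hx => ⟨by
        simp only [h₀, abs_neg]
        exact abs_le.mpr ⟨hx.1, hx.2⟩, by simp only [h₁]; exact le_rfl⟩)
      (by simp only [h₀]; norm_num) (by simp only [h₁, zero_add, one_add_one_eq_two, h₂]; linarith)
      (by simp only [zero_add, one_add_one_eq_two, h₂]; linarith)
  simp only [mul_zero, mul_one, zero_add] at hQ hP
  rw [Nat.sub_add_cancel hlt.le] at hP
  have heq : Q₂ = q₂ ∧ P₂ = p₂ := by
    have h := hF.coprime_add
    obtain ⟨c, hc⟩ : ((p₁ + p₂ : ℕ) : ℤ) ∣ P₂ - p₂ := by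
      refine (Nat.isCoprime_iff_coprime.mpr h.symm).dvd_of_dvd_mul_left ⟨Q₂ - q₂, ?_⟩
      have hd := hF.det
      have hd' := hF'.det
      zify at hQ hP hd hd'
      push_cast
      linear_combination (P₂ : ℤ) * hQ - (Q₂ : ℤ) * hP + hd - hd'
    have hP₁ := hF'.pos_left
    have hP₂ := hF'.pos
    have hp₁ := hF.pos_left
    have hp₂ := hF.pos
    have hc₀ : c = 0 := by
      by_contra hc₀
      rcases lt_or_gt_of_ne hc₀ with hc₀ | hc₀
      · have : c * ((p₁ + p₂ : ℕ) : ℤ) ≤ (-1) * ((p₁ + p₂ : ℕ) : ℤ) :=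
          mul_le_mul_of_nonneg_right (by omega) (by omega)
        rw [mul_comm] at this
        omega
      · have : 1 * ((p₁ + p₂ : ℕ) : ℤ) ≤ c * ((p₁ + p₂ : ℕ) : ℤ) :=
          mul_le_mul_of_nonneg_right (by omega) (by omega)
        rw [mul_comm c] at this
        omega
    obtain rfl : P₂ = p₂ := by
      rw [hc₀, mul_zero] at hc
      omega
    obtain rfl : P₁ = p₁ := by omega
    refine ⟨Nat.eq_of_mul_eq_mul_right (hF.pos_left.trans_le (Nat.le_add_right P₁ P₂)) ?_, rfl⟩
    have hd := hF.det
    have hd' := hF'.det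
    zify at hQ hd hd' ⊢
    linear_combination (-P₂ : ℤ) * hQ + hd' - hd
  obtain ⟨rfl, rfl⟩ := heq
  obtain rfl : Q₁ = q₁ := by omega
  obtain rfl : P₁ = p₁ := by omega
  refine ⟨L, -x, by linarith, hθ, fun u v huv hu hu' => ?_⟩
  rcases le_total (u * P₂) (Q₂ * v) with h | h
  · exact (hM L (-x) (by linarith)).three_le_of_mem_fan hF' hn hθ hb₁ hb₂ huv h (2 * n - 2)
      (by omega) hu'
  · exact hle u v huv h (by omega)

lemma exists_eq_div_of_nonneg {s : ℚ} (hs : 0 ≤ s) :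
    ∃ u v : ℕ, 0 < v ∧ u.Coprime v ∧ s = u / v := by
  refine ⟨s.num.natAbs, s.den, s.den_pos, s.reduced, ?_⟩
  conv_lhs => rw [← Rat.num_div_den s]
  rw [Nat.cast_natAbs, abs_of_nonneg (Rat.num_nonneg.mpr hs)]

lemma pow_notMem_heckN_of_ge {q₁ p₁ q₂ p₂ n j : ℕ} (hF : IsFarey q₁ p₁ q₂ p₂) (hn : 2 ≤ n)
    (hj : j + 2 ≤ 2 * n) {s : ℚ}
    (hs : (j * (q₁ + q₂) + q₂ : ℚ) / (j * (p₁ + p₂) + p₂) ≤ s) (hs₁ : s ≤ 1) {t : ℕ}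
    (ht : 1 ≤ t) : uWord s ^ t ∉ heckN ((q₁ + q₂ : ℚ) / (p₁ + p₂)) n := by
  have hp₁ := hF.pos_left
  have hp₂ := hF.pos
  have hs₀ : 0 ≤ s := le_trans (by positivity) hs
  obtain ⟨u, v, hv, huv, rfl⟩ := exists_eq_div_of_nonneg hs₀
  have hv' : (0 : ℚ) < v := by exact_mod_cast hv
  have hu : u ≤ v := by
    rw [div_le_one hv'] at hs₁
    exact_mod_cast hs₁
  have hs' : (j * (q₁ + q₂) + q₂) * v ≤ u * (j * (p₁ + p₂) + p₂) := by
    rw [div_le_div_iff₀ (by positivity) hv'] at hs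
    exact_mod_cast hs
  obtain ⟨i, hi⟩ : ∃ i, 2 * n - 2 = j + i := Nat.exists_eq_add_of_le (by omega)
  have hs'' : (q₁ + q₂) * v ≤ u * (p₁ + p₂) := by
    have hd := hF.det
    refine le_of_mul_le_mul_right ?_ (show 0 < j * (p₁ + p₂) + p₂ by positivity)
    have := Nat.mul_le_mul_right (p₁ + p₂) hs'
    nlinarith
  have hM (y x : ℝ) (hy : 2 ≤ y) : IsMarkoff (chTrace x y) :=
    isMarkoff_chTrace (by nlinarith [sq_nonneg x])
  have hT (y : ℝ) (q p : ℕ) : Continuous fun x => chTrace x y q p :=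
    Continuous.comp (g := fun z : ℝ × ℝ => chTrace z.1 z.2 q p) (f := fun x => (x, y))
      (continuous_chTrace q p) (Continuous.prodMk_left y)
  obtain ⟨y, x, hy, hθ, hle⟩ := exists_param (T := fun y x q p => chTrace x y q p) hM hT
    (fun y x => chTrace_zero_one x y) (fun y x => chTrace_one_one x y)
    (fun y x => chTrace_one_two x y) hF hn
  have h3 := hle u v huv hu (by
    rw [hi]
    have := Nat.mul_le_mul_left i hs''
    nlinarith)
  have key := pow_notMem_heckN (show 4 ≤ x ^ 2 + y ^ 2 by nlinarith [sq_nonneg x])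
    (Nat.add_pos_left hp₁ p₂) hF.add_lt_add.le hF.coprime_add hv hu huv hn hθ h3 ht
  rwa [Nat.cast_add, Nat.cast_add] at key

lemma pow_notMem_heckN_of_le {q₁ p₁ q₂ p₂ n j : ℕ} (hF : IsFarey q₁ p₁ q₂ p₂) (hn : 2 ≤ n)
    (hj : j + 2 ≤ 2 * n) {s : ℚ} (hs₀ : 0 ≤ s)
    (hs : s ≤ (j * (q₁ + q₂) + q₁ : ℚ) / (j * (p₁ + p₂) + p₁)) {t : ℕ}
    (ht : 1 ≤ t) : uWord s ^ t ∉ heckN ((q₁ + q₂ : ℚ) / (p₁ + p₂)) n := by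
  have hp₁ := hF.pos_left
  have hp₂ := hF.pos
  have hF' : IsFarey (p₂ - q₂) p₂ (p₁ - q₁) p₁ := by
    obtain ⟨a₁, rfl⟩ := Nat.exists_eq_add_of_le hF.le_left
    obtain ⟨a₂, rfl⟩ := Nat.exists_eq_add_of_le hF.le_right
    simp only [Nat.add_sub_cancel_left]
    exact ⟨by have := hF.det; nlinarith, hp₁, by omega, by omega⟩
  have hr : p₁ + p₂ - (p₂ - q₂ + (p₁ - q₁)) = q₁ + q₂ := by
    have := hF.le_left
    have := hF.le_right
    omega
  obtain ⟨u, v, hv, huv, rfl⟩ := exists_eq_div_of_nonneg hs₀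
  have hv' : (0 : ℚ) < v := by exact_mod_cast hv
  have hs' : u * (j * (p₁ + p₂) + p₁) ≤ (j * (q₁ + q₂) + q₁) * v := by
    rw [div_le_div_iff₀ hv' (by positivity)] at hs
    exact_mod_cast hs
  have hs'' : u * (p₁ + p₂) ≤ (q₁ + q₂) * v := by
    have hd := hF.det
    refine le_of_mul_le_mul_right ?_ (show 0 < j * (p₁ + p₂) + p₁ by positivity)
    have := Nat.mul_le_mul_right (p₁ + p₂) hs'
    nlinarith
  have hu : u ≤ v := by
    refine le_of_mul_le_mul_right ?_ (Nat.add_pos_left hp₁ p₂)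
    have := Nat.mul_le_mul_right v hF.add_lt_add.le
    nlinarith
  obtain ⟨i, hi⟩ : ∃ i, 2 * n - 2 = j + i := Nat.exists_eq_add_of_le (by omega)
  have hM (y x : ℝ) (hy : 2 ≤ y) : IsMarkoff fun q p => chTrace y x (p - q) p :=
    (isMarkoff_chTrace (by nlinarith [sq_nonneg x])).reflect
  have hT (y : ℝ) (q p : ℕ) : Continuous fun x => chTrace y x (p - q) p :=
    Continuous.comp (g := fun z : ℝ × ℝ => chTrace z.1 z.2 (p - q) p) (f := fun x => (y, x))
      (continuous_chTrace (p - q) p) (Continuous.prodMk_right y)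
  obtain ⟨y, x, hy, hθ, hle⟩ := exists_param (T := fun y x q p => chTrace y x (p - q) p) hM hT
    (fun y x => chTrace_one_one y x) (fun y x => chTrace_zero_one y x)
    (fun y x => (chTrace_one_two y x).trans (mul_comm y x)) hF' hn
  have h3 := hle (v - u) v ((Nat.coprime_self_sub_left hu).mpr huv) (Nat.sub_le v u) (by
    rw [hi]
    have := Nat.mul_le_mul_left i hs''
    obtain ⟨w, rfl⟩ := Nat.exists_eq_add_of_le hu
    obtain ⟨a₁, rfl⟩ := Nat.exists_eq_add_of_le hF.le_left
    obtain ⟨a₂, rfl⟩ := Nat.exists_eq_add_of_le hF.le_right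
    simp only [Nat.add_sub_cancel_left]
    nlinarith)
  simp only [add_comm p₂, hr] at hθ
  rw [Nat.sub_sub_self hu] at h3
  have key := pow_notMem_heckN (show 4 ≤ y ^ 2 + x ^ 2 by nlinarith [sq_nonneg x])
    (Nat.add_pos_left hp₁ p₂) hF.add_lt_add.le hF.coprime_add hv hu huv hn hθ h3 ht
  rwa [Nat.cast_add, Nat.cast_add] at key

lemma cfQ_append (L : List ℕ) (hL : ∀ x ∈ L, 0 < x) :
    ∃ h k h' k' : ℕ, 0 < k ∧ (L ≠ [] → h ≤ k ∧ h' ≤ k') ∧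
      (h' : ℤ) * k - h * k' = (-1) ^ L.length ∧
        ∀ T, 0 ≤ cfQ T → cfQ (L ++ T) = (h + h' * cfQ T) / (k + k' * cfQ T) := by
  induction L with
  | nil => exact ⟨0, 1, 1, 0, one_pos, by simp, by simp, by simp⟩
  | cons a L ih =>
    obtain ⟨h, k, h', k', hk, -, hd, hcf⟩ := ih fun x hx => hL x (List.mem_cons_of_mem a hx)
    have ha : 0 < a := hL a List.mem_cons_self
    refine ⟨k, a * k + h, k', a * k' + h', by positivity, fun _ => ⟨by nlinarith, by nlinarith⟩,
      ?_, fun T hT => ?_⟩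
    · rw [List.length_cons, pow_succ, ← hd]
      push_cast
      ring
    · rw [List.cons_append, cfQ, hcf T hT]
      have : (0 : ℚ) < k + k' * cfQ T := by positivity
      have ha' : (0 : ℚ) < a := by exact_mod_cast ha
      have : (0 : ℚ) < a * k + h + (a * k' + h') * cfQ T := by positivity
      push_cast
      field_simp
      ring

/-- Main Theorem (3): for `s ∈ I₁(r;n) ∪ I₂(r;n)`, the element `u_s` is not a
torsion element of `Heck(r;n)`: `u_s^t ≠ 1` for every `t ≥ 1`. -/
theorem statement1
    (M : List ℕ) (m n : ℕ) (r : ℚ)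
    (hMlen : 2 ≤ M.length) (hMpos : ∀ x ∈ M, 0 < x) (hMlast : 2 ≤ M.getLast!)
    (hm : M.head? = some m) (hn : 2 ≤ n) (hr : r = cfQ M)
    (s : ℚ) (hs : memI1 M n s ∨ memI2 M n s) :
    ∀ t : ℕ, 1 ≤ t → uWord s ^ t ∉ heckN r n := by
  intro t ht
  subst hr
  obtain ⟨L, z, rfl⟩ : ∃ L z, M = L ++ [z + 2] := by
    have hM : M ≠ [] := List.ne_nil_of_length_pos (by omega)
    rw [List.getLast!_of_getLast? (List.getLast?_eq_getLast_of_ne_nil hM)] at hMlast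
    refine ⟨M.dropLast, M.getLast hM - 2, ?_⟩
    rw [Nat.sub_add_cancel hMlast, List.dropLast_append_getLast]
  have hL : L ≠ [] := by
    rintro rfl
    simp at hMlen
  obtain ⟨N, rfl⟩ : ∃ N, n = N + 2 := ⟨n - 2, by omega⟩
  obtain ⟨h, k, h', k', hk, hle, hd, hcf⟩ := cfQ_append L fun x hx => hMpos x (by simp [hx])
  obtain ⟨hhk, hhk'⟩ := hle hL
  have hk₀ : (0 : ℚ) < k := by exact_mod_cast hk
  have hr : cfQ (L ++ [z + 2]) = (h + (h * (z + 1) + h') : ℚ) / (k + (k * (z + 1) + k')) := by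
    rw [hcf _ (by simp only [cfQ]; positivity)]
    simp only [cfQ]
    push_cast
    field_simp
    ring
  have hnear : cfQ (L ++ [z + 1, 2]) =
      ((h + (h * (z + 1) + h')) + (h * (z + 1) + h') : ℚ) /
        ((k + (k * (z + 1) + k')) + (k * (z + 1) + k')) := by
    rw [hcf _ (by simp only [cfQ]; positivity)]
    simp only [cfQ]
    push_cast
    field_simp
    ring
  have hfar : cfQ (L ++ [z + 2, 2 * (N + 2) - 2]) =
      ((2 * N + 2) * (h + (h * (z + 1) + h')) + h : ℚ) /
        ((2 * N + 2) * (k + (k * (z + 1) + k')) + k) := by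
    rw [show 2 * (N + 2) - 2 = 2 * N + 2 by omega, hcf _ (by simp only [cfQ]; positivity)]
    simp only [cfQ]
    push_cast
    field_simp
    ring
  have hlast : (L ++ [z + 2]).getLast! - 1 = z + 1 := by simp
  simp only [memI1, memI2, List.dropLast_concat, hlast, List.append_assoc, List.cons_append,
    List.nil_append, List.length_append, List.length_singleton, Nat.even_add_one, hnear, hfar] at hs
  rcases Nat.even_or_odd L.length with hL' | hL'
  · simp only [hL', not_true, if_false] at hs
    rw [hL'.neg_one_pow] at hd
    have hF : IsFarey h k (h * (z + 1) + h') (k * (z + 1) + k') :=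
      ⟨by zify; linear_combination hd, by positivity, hhk, by gcongr⟩
    have hr' : cfQ (L ++ [z + 2]) =
        (h + (h * (z + 1) + h' : ℕ) : ℚ) / (k + (k * (z + 1) + k' : ℕ)) := by
      rw [hr]
      push_cast
      rfl
    rw [hr']
    rcases hs with ⟨hs₀, hs⟩ | ⟨hs, hs₁⟩
    · exact pow_notMem_heckN_of_le hF hn (j := 2 * N + 2) (by omega) hs₀
        (by push_cast; exact hs.le) ht
    · exact pow_notMem_heckN_of_ge hF hn (j := 1) (by omega)
        (by push_cast; rwa [one_mul, one_mul]) hs₁ ht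
  · simp only [Nat.not_even_iff_odd.mpr hL', not_false_iff, if_true] at hs
    rw [hL'.neg_one_pow] at hd
    have hF : IsFarey (h * (z + 1) + h') (k * (z + 1) + k') h k :=
      ⟨by zify; linear_combination -hd, hk, by gcongr, hhk⟩
    have hr' : cfQ (L ++ [z + 2]) =
        ((h * (z + 1) + h' : ℕ) + h : ℚ) / ((k * (z + 1) + k' : ℕ) + k) := by
      rw [hr, add_comm, add_comm (k : ℚ)]
      push_cast
      rfl
    rw [hr']
    rw [add_comm (h : ℚ), add_comm (k : ℚ)] at hs
    rcases hs with ⟨hs₀, hs⟩ | ⟨hs, hs₁⟩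
    · exact pow_notMem_heckN_of_le hF hn (j := 1) (by omega) hs₀
        (by push_cast; rwa [one_mul, one_mul]) ht
    · exact pow_notMem_heckN_of_ge hF hn (j := 2 * N + 2) (by omega)
        (by push_cast; exact hs.le) hs₁ ht

end Heckoid
end

section
/- For any rational number s ∈ I_1(r;n) ∪ I_2(r;n) the following hold: (1) if k is even, then CS(s) does not contain ((2n−2)⟨S_1, S_2⟩, S_1) as a subsequence; (2) if k is odd, then CS(s) does not contain ((2n−2)⟨S_2, S_1⟩, S_2) as a subsequence. -/
/- Formalization of statements from "Homotopically equivalent simple loops on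
2-bridge spheres in Heckoid orbifolds for 2-bridge links (II)" by Lee-Sakuma.

We work in the free group `F` on two generators `a = gen 0`, `b = gen 1`.
For a rational `s` (in lowest terms `q/p`, with `0 ≤ s ≤ 1`), `uWord s` is the
word `u_s = a b^{ε₁} a^{ε₂} ⋯ b^{ε_{2p-1}}` with `ε_i = (-1)^⌊i·s⌋`.
`CS s` is (a linear representative of) the cyclic sequence of lengths of
maximal constant-sign runs of exponents of `u_s`; since `u_s` begins with a
positive letter and (for `0 < s ≤ 1`) ends with a negative letter, the linear
run-length sequence represents the cyclic one.  `CyclicContains L T` says the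
cyclic sequence represented by `L` contains `T` as a block of consecutive
terms.  `cfQ [m₁,…,m_k]` is the continued fraction `1/(m₁+1/(m₂+⋯+1/m_k))`.
`memI1 M n s` / `memI2 M n s` express `s ∈ I₁(r;n)` / `s ∈ I₂(r;n)` where
`r = cfQ M`, and `memI1hat` / `memI2hat` express `s ∈ I₁(r)` / `s ∈ I₂(r)`.
The Heckoid group `Heck(r;n) = ⟨a,b | u_r^n⟩` is the quotient of `F` by the
normal closure `heckN r n` of `u_r^n`, with quotient map `heckQ r n`. -/

namespace Heckoid

/-- The index `⌈j * p / q⌉` at which the `j`-th run of `signList (q / p)` starts. -/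
def runStart (p q j : ℕ) : ℕ := (j * p + q - 1) / q

theorem runStart_le_iff {p q : ℕ} (hq : 0 < q) (i j : ℕ) :
    runStart p q j ≤ i ↔ j * p ≤ i * q := by
  unfold runStart
  rw [← Nat.lt_succ_iff, Nat.div_lt_iff_lt_mul hq, Nat.succ_mul]
  omega

theorem mul_le_runStart_mul {p q : ℕ} (hq : 0 < q) (j : ℕ) :
    j * p ≤ runStart p q j * q :=
  (runStart_le_iff hq _ _).1 le_rfl

theorem runStart_mul_lt {p q : ℕ} (hq : 0 < q) (j : ℕ) :
    runStart p q j * q < j * p + q := by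
  have h := Nat.div_mul_le_self (j * p + q - 1) q
  unfold runStart
  omega

theorem runStart_unique {p q j e : ℕ} (hq : 0 < q) (h₁ : j * p ≤ e * q)
    (h₂ : e * q < j * p + q) : runStart p q j = e := by
  refine le_antisymm ((runStart_le_iff hq _ _).2 h₁) ?_
  have h := mul_le_runStart_mul (p := p) hq j
  by_contra! hlt
  have : (runStart p q j + 1) * q ≤ e * q := Nat.mul_le_mul_right q hlt
  rw [Nat.succ_mul] at this
  omega

theorem runStart_zero {p q : ℕ} (hq : 0 < q) : runStart p q 0 = 0 :=
  runStart_unique hq (by simp) (by simpa using hq)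

theorem runStart_add_period {p q : ℕ} (hq : 0 < q) (j : ℕ) :
    runStart p q (j + q) = runStart p q j + p := by
  have h₁ := mul_le_runStart_mul (p := p) hq j
  have h₂ := runStart_mul_lt (p := p) hq j
  apply runStart_unique hq <;> nlinarith

theorem runStart_lt_succ {p q : ℕ} (hq : 0 < q) (hqp : q ≤ p) (j : ℕ) :
    runStart p q j < runStart p q (j + 1) := by
  have h₁ := runStart_mul_lt (p := p) hq j
  have h₂ := mul_le_runStart_mul (p := p) hq (j + 1)
  have : runStart p q j * q < runStart p q (j + 1) * q := by nlinarith
  exact Nat.lt_of_mul_lt_mul_right this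

/-- The length of the `j`-th run of `signList (q / p)`. -/
def runLen (p q j : ℕ) : ℕ := runStart p q (j + 1) - runStart p q j

theorem runStart_add_runLen {p q : ℕ} (hq : 0 < q) (hqp : q ≤ p) (j : ℕ) :
    runStart p q j + runLen p q j = runStart p q (j + 1) := by
  have := runStart_lt_succ hq hqp j
  unfold runLen
  omega

theorem runLen_periodic {p q : ℕ} (hq : 0 < q) :
    Function.Periodic (runLen p q) q := by
  intro j
  unfold runLen
  rw [show j + q + 1 = j + 1 + q by ring, runStart_add_period hq, runStart_add_period hq]
  omega

theorem sum_runLen {p q : ℕ} (hq : 0 < q) (hqp : q ≤ p) (j L : ℕ) :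
    ((List.range L).map fun i => runLen p q (j + i)).sum + runStart p q j =
      runStart p q (j + L) := by
  induction L with
  | zero => simp
  | succ L ih =>
    have := runStart_add_runLen hq hqp (j + L)
    simp only [List.range_succ, List.map_append, List.sum_append, List.map_cons, List.map_nil,
      List.sum_cons, List.sum_nil]
    rw [← add_assoc j L 1]
    omega

theorem floor_natCast_mul_toNat {s : ℚ} (hs : 0 ≤ s) (i : ℕ) :
    ⌊(i : ℚ) * s⌋.toNat = i * s.num.toNat / s.den := by
  have hnum : ((s.num.toNat : ℕ) : ℤ) = s.num := Int.toNat_of_nonneg (Rat.num_nonneg.2 hs)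
  have h : (i : ℚ) * s = ((i * s.num.toNat : ℕ) : ℚ) / (s.den : ℚ) := by
    conv_lhs => rw [← Rat.num_div_den s, ← hnum]
    push_cast
    ring
  rw [h, Int.floor_toNat, Nat.floor_div_eq_div]

theorem map_range_runStart {α : Type} {p q : ℕ} (hq : 0 < q) (hqp : q ≤ p) (f : ℕ → α) (N : ℕ) :
    (List.range (runStart p q N)).map (fun i => f (i * q / p)) =
      ((List.range N).map fun j => List.replicate (runLen p q j) (f j)).flatten := by
  have hp : 0 < p := hq.trans_le hqp
  induction N with
  | zero => simp [runStart_zero hq]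
  | succ N ih =>
    rw [← runStart_add_runLen hq hqp, List.range_add, List.map_append, ih, List.range_succ,
      List.map_append, List.flatten_append]
    congr 1
    simp only [List.map_map, List.map_cons, List.map_nil, List.flatten_cons, List.flatten_nil,
      List.append_nil]
    rw [List.eq_replicate_iff]
    refine ⟨by simp, fun b hb => ?_⟩
    obtain ⟨i, hi, rfl⟩ := List.mem_map.1 hb
    have hi' := List.mem_range.1 hi
    have h₁ : N * p ≤ (runStart p q N + i) * q := (runStart_le_iff hq _ _).1 (by omega)
    have h₂ : (runStart p q N + i) * q < (N + 1) * p := by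
      by_contra! h
      have := (runStart_le_iff hq _ _).2 h
      have := runStart_add_runLen hq hqp N
      omega
    simp only [Function.comp]
    rw [Nat.div_eq_of_lt_le h₁ h₂]

theorem runLengths_flatten_replicate (c : ℕ → ℕ) (hc : ∀ j, 0 < c j) (N : ℕ) :
    runLengths ((List.range N).map fun j => List.replicate (c j) ((-1 : ℤ) ^ j)).flatten =
      (List.range N).map c := by
  unfold runLengths
  rw [List.splitBy_flatten]
  · simp [List.map_map, Function.comp_def]
  · simp only [List.mem_map, not_exists, not_and]
    intro j _ h
    have := hc j
    rw [List.replicate_eq_nil_iff] at h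
    omega
  · intro l hl
    obtain ⟨j, _, rfl⟩ := List.mem_map.1 hl
    exact List.isChain_replicate_of_rel _ (by simp)
  · rw [List.isChain_map]
    rw [List.isChain_range]
    intro j _
    have h₀ := (hc j).ne'
    have h₁ := (hc j.succ).ne'
    refine ⟨by simpa using h₀, by simpa using h₁, ?_⟩
    rcases neg_one_pow_eq_or ℤ j with h | h <;> simp [pow_succ, h]

theorem CS_eq_map_runLen {s : ℚ} (hs₀ : 0 < s) (hs₁ : s ≤ 1) :
    CS s = (List.range (2 * s.num.toNat)).map (runLen s.den s.num.toNat) := by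
  have hnum : 0 < s.num.toNat := by have := Rat.num_pos.2 hs₀; omega
  have hle : s.num.toNat ≤ s.den := by have := Rat.num_le_denom_iff.2 hs₁; omega
  have hstart : runStart s.den s.num.toNat (2 * s.num.toNat) = 2 * s.den := by
    apply runStart_unique hnum <;> nlinarith
  have hpos : ∀ j, 0 < runLen s.den s.num.toNat j := fun j =>
    Nat.sub_pos_of_lt (runStart_lt_succ hnum hle j)
  rw [← runLengths_flatten_replicate _ hpos, ← map_range_runStart hnum hle, hstart]
  simp only [CS, signList, bind_pure_comp, List.map_eq_map, List.map_map, Function.comp_def,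
    floor_natCast_mul_toNat hs₀.le]

/-- The sum of a block of consecutive terms of the cyclic sequence `CS (q / p)`. -/
theorem exists_runStart_of_infix {p q : ℕ} (hq : 0 < q) (hqp : q ≤ p) {k : ℕ} {B : List ℕ}
    (hB : B <:+: ((List.range (2 * q)).map (runLen p q)).rotate k) :
    ∃ j, B.sum + runStart p q j = runStart p q (j + B.length) := by
  obtain ⟨A, C, h⟩ := hB
  refine ⟨A.length + k, ?_⟩
  rw [← sum_runLen hq hqp (A.length + k) B.length]
  congr 2
  refine List.ext_getElem (by simp) fun i h₁ h₂ => ?_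
  have hper : Function.Periodic (runLen p q) (2 * q) := (runLen_periodic hq).nat_mul 2
  have hlen : A.length + i < (A ++ B ++ C).length := by
    simp only [List.length_append]
    omega
  have e₁ : B[i] = (A ++ B ++ C)[A.length + i] := by
    simp [h₁]
  rw [e₁]
  simp only [h, List.getElem_rotate, List.getElem_map, List.getElem_range, List.length_map,
    List.length_range, hper.map_mod_nat]
  congr 1
  omega

theorem sum_infix_bounds {p q : ℕ} (hq : 0 < q) (hqp : q ≤ p) {k : ℕ} {B : List ℕ}
    (hB : B <:+: ((List.range (2 * q)).map (runLen p q)).rotate k) :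
    B.sum * q < B.length * p + q ∧ B.length * p < B.sum * q + q := by
  obtain ⟨j, hj⟩ := exists_runStart_of_infix hq hqp hB
  have h₁ := mul_le_runStart_mul (p := p) hq j
  have h₂ := runStart_mul_lt (p := p) hq j
  have h₃ := mul_le_runStart_mul (p := p) hq (j + B.length)
  have h₄ := runStart_mul_lt (p := p) hq (j + B.length)
  rw [← hj] at h₃ h₄
  constructor <;> nlinarith

theorem sum_take_of_palindrome {l : List ℕ} (hl : l.reverse = l) (j : ℕ) :
    (l.take j).sum + (l.take (l.length - j)).sum = l.sum := by
  have h : (l.take j).sum = (l.drop (l.length - j)).sum := by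
    conv_lhs => rw [← hl, List.take_reverse, List.sum_reverse]
  rw [h, add_comm, List.sum_take_add_sum_drop]

/-- If the period `CS (q / p)` is a product of two nonempty palindromes, then the length and the
sum of the first of them are determined by the inverse `u` of `p` modulo `q`. -/
theorem palindrome_length_sum {p q u v : ℕ} (hq : 0 < q) (hqp : q ≤ p)
    (huv : u * p = v * q + 1) (huq : u < q) {S1 S2 : List ℕ}
    (hdec : (List.range (2 * q)).map (runLen p q) = S1 ++ S2 ++ S1 ++ S2)
    (hS1ne : S1 ≠ []) (hS2ne : S2 ≠ [])
    (hS1pal : S1.reverse = S1) (hS2pal : S2.reverse = S2) :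
    S1.length = u ∧ S1.sum = v + 1 ∧ S1.length + S2.length = q ∧ S1.sum + S2.sum = p := by
  have hl₁ := List.length_pos_iff.2 hS1ne
  have hl₂ := List.length_pos_iff.2 hS2ne
  have hlen : S1.length + S2.length = q := by
    have := congrArg List.length hdec
    simp only [List.length_map, List.length_range, List.length_append] at this
    omega
  have hperiod : S1 ++ S2 = (List.range q).map (runLen p q) := by
    have := congrArg (List.take q) hdec
    rw [List.append_assoc, List.take_left' (by simpa using hlen), ← List.map_take,
      List.take_range, min_eq_left (by omega)] at this
    exact this.symm
  have hprefix : ∀ j ≤ q, ((S1 ++ S2).take j).sum = runStart p q j := by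
    intro j hj
    have := sum_runLen hq hqp 0 j
    simp only [zero_add, runStart_zero hq, add_zero] at this
    rw [hperiod, ← List.map_take, List.take_range, min_eq_left hj, this]
  have hE₁ : runStart p q S1.length = S1.sum := by
    rw [← hprefix _ (by omega), List.take_left]
  have hEq : runStart p q q = p := by
    simpa [runStart_zero hq] using runStart_add_period (p := p) hq 0
  have hsum : S1.sum + S2.sum = p := by
    rw [← hEq, ← hprefix _ le_rfl, ← hlen, ← List.length_append, List.take_length,
      List.sum_append]
  have hEu : runStart p q u = v + 1 := by
    apply runStart_unique hq
    · nlinarith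
    · nlinarith
  have hrefl : runStart p q (S1.length + q - u) + runStart p q u = S1.sum + p := by
    rcases le_or_gt u S1.length with h | h
    · have := sum_take_of_palindrome hS1pal u
      rw [show S1.length + q - u = (S1.length - u) + q by omega, runStart_add_period hq,
        ← hprefix _ (by omega), ← hprefix u (by omega), List.take_append_of_le_length h,
        List.take_append_of_le_length (by omega)]
      omega
    · have := sum_take_of_palindrome hS2pal (u - S1.length)
      rw [← hprefix _ (by omega), ← hprefix u (by omega), List.take_append, List.take_append,
        List.take_of_length_le (l := S1) (by omega), List.take_of_length_le (l := S1) (by omega),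
        List.sum_append, List.sum_append,
        show S1.length + q - u - S1.length = S2.length - (u - S1.length) by omega]
      omega
  have h₁ := mul_le_runStart_mul (p := p) hq (S1.length + q - u)
  have h₂ := runStart_mul_lt (p := p) hq S1.length
  rw [hE₁] at h₂
  rw [hEu] at hrefl
  generalize S1.sum = σ at h₂ hrefl hsum ⊢
  zify [show u ≤ S1.length + q by omega] at h₁ h₂ hrefl huv
  have hkey : (σ : ℤ) * q = S1.length * p + q - 1 := by
    have : (runStart p q (S1.length + q - u) : ℤ) = σ + p - (v + 1) := by linarith
    rw [this] at h₁
    nlinarith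
  have hcop : IsCoprime (q : ℤ) (p : ℤ) := ⟨-v, u, by linarith⟩
  have hdvd : (q : ℤ) ∣ (S1.length : ℤ) - u :=
    hcop.dvd_of_dvd_mul_right ⟨(σ : ℤ) - 1 - v, by linarith⟩
  have hzero : (S1.length : ℤ) - u = 0 :=
    Int.eq_zero_of_abs_lt_dvd hdvd (abs_lt.2 ⟨by omega, by omega⟩)
  have hlu : S1.length = u := by omega
  refine ⟨hlu, ?_, hlen, hsum⟩
  rw [hlu] at hkey
  have : ((σ : ℤ) - (v + 1)) * q = 0 := by linarith
  have := (mul_eq_zero.1 this).resolve_right (by positivity)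
  omega

theorem cfQ_nonneg (l : List ℕ) : 0 ≤ cfQ l := by
  induction l with
  | nil => simp [cfQ]
  | cons a l ih => unfold cfQ; positivity

/-- Prepending `M` to a continued fraction acts by the Möbius transformation whose coefficients
are the last two convergents of `M`. -/
theorem exists_convergents (M : List ℕ) (hM : ∀ x ∈ M, 0 < x) :
    ∃ A B C D : ℕ, (A * D - B * C : ℤ) = -(-1) ^ M.length ∧ 0 < C ∧ A ≤ C ∧
      (M ≠ [] → 0 < A ∧ B ≤ D) ∧
      ∀ l, cfQ (M ++ l) = (A + B * cfQ l) / (C + D * cfQ l) := by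
  induction M with
  | nil => exact ⟨0, 1, 1, 0, by simp, by simp, by simp, by simp, fun l => by simp⟩
  | cons a M ih =>
    obtain ⟨A, B, C, D, hdet, hC, hAC, -, h⟩ := ih fun x hx => hM x (List.mem_cons_of_mem _ hx)
    have ha : 0 < a := hM a List.mem_cons_self
    refine ⟨C, D, a * C + A, a * D + B, ?_, by positivity, by nlinarith, fun _ => ⟨hC, by nlinarith⟩,
      fun l => ?_⟩
    · push_cast
      rw [List.length_cons, pow_succ]
      linear_combination -hdet
    · have hl := cfQ_nonneg l
      have hC' : (0 : ℚ) < C := by exact_mod_cast hC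
      have : (C : ℚ) + D * cfQ l ≠ 0 := by positivity
      have ha' : (0 : ℚ) < a := by exact_mod_cast ha
      have : (a : ℚ) * C + A + (a * D + B) * cfQ l ≠ 0 := by positivity
      have : (a : ℚ) * (C + D * cfQ l) + (A + B * cfQ l) ≠ 0 := by
        convert this using 1; ring
      rw [List.cons_append, cfQ, h]
      push_cast
      field_simp
      ring

/-- The numerators and denominators of `r = [m₁, …, m_k]`, of its previous convergent, and of the
endpoints of the intervals around `r`. -/
theorem exists_cfQ_endpoints (M : List ℕ) (hMlen : 2 ≤ M.length) (hMpos : ∀ x ∈ M, 0 < x)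
    (hMlast : 2 ≤ M.getLast!) :
    ∃ q p q' p' : ℕ, (q' * p - p' * q : ℤ) = (-1) ^ M.length ∧ 0 < q' ∧ q' < q ∧ 0 < p' ∧ p' < p ∧
      q ≤ p ∧ cfQ M = q / p ∧
      (∀ x : ℕ, 0 < x → cfQ (M ++ [x]) = (x * q + q') / (x * p + p')) ∧
      cfQ (M.dropLast ++ [M.getLast! - 1, 2]) = (2 * q - q') / (2 * p - p') := by
  have hne : M ≠ [] := by rintro rfl; simp at hMlen
  obtain ⟨N, x, rfl⟩ : ∃ N x, M = N ++ [x] :=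
    ⟨M.dropLast, M.getLast hne, (List.dropLast_append_getLast hne).symm⟩
  have hx : 2 ≤ x := by simpa [List.getLast!_eq_getLast?_getD] using hMlast
  obtain ⟨A, B, C, D, hdet, hC, hAC, hN, h⟩ :=
    exists_convergents N fun y hy => hMpos y (List.mem_append_left _ hy)
  have hNne : N ≠ [] := by rintro rfl; simp at hMlen
  obtain ⟨hA, hBD⟩ := hN hNne
  have hx' : (2 : ℚ) ≤ x := by exact_mod_cast hx
  have hC' : (0 : ℚ) < C := by exact_mod_cast hC
  refine ⟨A * x + B, C * x + D, A, C, ?_, hA, by nlinarith, hC, by nlinarith, by nlinarith, ?_, ?_, ?_⟩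
  · push_cast
    rw [List.length_append, List.length_singleton, pow_succ]
    linear_combination hdet
  · rw [h]
    simp only [cfQ]
    push_cast
    field_simp
    ring
  · intro y hy
    have hy' : (0 : ℚ) < y := by exact_mod_cast hy
    rw [List.append_assoc, h]
    simp only [cfQ, List.cons_append, List.nil_append]
    push_cast
    rw [div_eq_div_iff (by positivity) (by positivity)]
    field_simp
    ring
  · rw [List.dropLast_concat, h]
    simp only [cfQ, List.getLast!_eq_getLast?_getD, List.getLast?_append, List.getLast?_singleton,
      Option.some_or, Option.getD_some]
    push_cast [show 1 ≤ x by omega]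
    have h₁ : (0 : ℚ) < x - 1 := by linarith
    have h₂ : (0 : ℚ) < 2 * (C * x + D) - C := by
      have : (0 : ℚ) ≤ D := by positivity
      nlinarith
    rw [div_eq_div_iff (by positivity) h₂.ne']
    field_simp
    ring

theorem length_rep2 (d : ℕ) (T T' : List ℕ) :
    (rep2 d T T').length = d * (T.length + T'.length) := by
  simp [rep2, List.length_flatten]

theorem sum_rep2 (d : ℕ) (T T' : List ℕ) : (rep2 d T T').sum = d * (T.sum + T'.sum) := by
  simp [rep2, List.sum_flatten]

theorem rep2_succ (d : ℕ) (T T' : List ℕ) : rep2 (d + 1) T T' = T ++ (T' ++ rep2 d T T') := by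
  simp [rep2, List.replicate_succ]

/-- Bounds on the sums of `d⟨T, T'⟩, T` and of its inner block `T', (d-1)⟨T, T'⟩`. -/
theorem bounds_of_cyclicContains {s : ℚ} (hs₀ : 0 < s) (hs₁ : s ≤ 1) {d : ℕ} {T T' : List ℕ}
    (h : CyclicContains (CS s) (rep2 (d + 1) T T' ++ T)) :
    (((d + 1) * (T.sum + T'.sum) + T.sum - 1 : ℚ) * s < (d + 1) * (T.length + T'.length) + T.length ∧
      ((d + 1) * (T.length + T'.length) + T.length : ℚ) <
        ((d + 1) * (T.sum + T'.sum) + T.sum + 1) * s) ∧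
    (((d + 1) * (T.sum + T'.sum) - T.sum - 1 : ℚ) * s < (d + 1) * (T.length + T'.length) - T.length ∧
      ((d + 1) * (T.length + T'.length) - T.length : ℚ) <
        ((d + 1) * (T.sum + T'.sum) - T.sum + 1) * s) := by
  have hnum : 0 < s.num.toNat := by have := Rat.num_pos.2 hs₀; omega
  have hle : s.num.toNat ≤ s.den := by have := Rat.num_le_denom_iff.2 hs₁; omega
  have key : ∀ {k : ℕ} {B : List ℕ}, B <:+: (CS s).rotate k →
      ((B.sum - 1 : ℚ) * s < B.length ∧ (B.length : ℚ) < (B.sum + 1) * s) := by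
    intro k B hB
    rw [CS_eq_map_runLen hs₀ hs₁] at hB
    obtain ⟨h₁, h₂⟩ := sum_infix_bounds hnum hle hB
    have hcast : ((s.num.toNat : ℕ) : ℚ) = s * s.den := by
      rw [Rat.mul_den_eq_num]
      exact_mod_cast Int.toNat_of_nonneg (Rat.num_nonneg.2 hs₀.le)
    have hden : (0 : ℚ) < s.den := by exact_mod_cast s.den_pos
    generalize B.sum = σ at h₁ h₂ ⊢
    generalize B.length = L at h₁ h₂ ⊢
    qify at h₁ h₂
    rw [hcast] at h₁ h₂
    constructor <;> refine lt_of_mul_lt_mul_right ?_ hden.le <;> linarith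
  obtain ⟨k, hk⟩ := h
  refine ⟨?_, ?_⟩
  · have := key hk.isInfix
    simp only [List.length_append, List.sum_append, length_rep2, sum_rep2] at this
    simpa only [Nat.cast_add, Nat.cast_mul, Nat.cast_one] using this
  · have hin : T' ++ rep2 d T T' <:+: rep2 (d + 1) T T' ++ T := by
      rw [rep2_succ]
      exact ⟨T, T, by simp⟩
    have := key (hin.trans hk.isInfix)
    simp only [List.length_append, List.sum_append, length_rep2, sum_rep2] at this
    simp only [Nat.cast_add, Nat.cast_mul] at this
    constructor <;> linarith

theorem not_cyclicContains_CS_zero (d : ℕ) {T T' : List ℕ} (hT : T ≠ []) :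
    ¬ CyclicContains (CS 0) (rep2 (d + 1) T T' ++ T) := by
  rintro ⟨k, hk⟩
  have hCS : (CS 0).length = 1 := by
    simp only [CS, signList, bind_pure_comp, List.map_eq_map, List.map_map, Function.comp_def,
      mul_zero, Int.floor_zero, Int.toNat_zero, pow_zero]
    rfl
  have hlen := hk.length_le
  have hT' := List.length_pos_iff.2 hT
  rw [List.length_rotate, hCS, rep2_succ] at hlen
  simp only [List.length_append] at hlen
  omega

/-- Lemma 2.1: for `s ∈ I₁(r;n) ∪ I₂(r;n)`: if `k` is even then `CS(s)` does not
contain `((2n-2)⟨S₁,S₂⟩, S₁)`; if `k` is odd then `CS(s)` does not contain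
`((2n-2)⟨S₂,S₁⟩, S₂)`. -/
theorem statement2
    (M : List ℕ) (m n : ℕ) (r : ℚ)
    (hMlen : 2 ≤ M.length) (hMpos : ∀ x ∈ M, 0 < x) (hMlast : 2 ≤ M.getLast!)
    (hm : M.head? = some m) (hn : 2 ≤ n) (hr : r = cfQ M)
    (S1 S2 : List ℕ) (hdec : CS r = S1 ++ S2 ++ S1 ++ S2)
    (hS1ne : S1 ≠ []) (hS2ne : S2 ≠ [])
    (hS1pal : S1.reverse = S1) (hS2pal : S2.reverse = S2)
    (hS1h : S1.head? = some (m + 1)) (hS2h : S2.head? = some m)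
    (s : ℚ) (hs : memI1 M n s ∨ memI2 M n s) :
    (Even M.length → ¬ CyclicContains (CS s) (rep2 (2 * n - 2) S1 S2 ++ S1)) ∧
    (¬ Even M.length → ¬ CyclicContains (CS s) (rep2 (2 * n - 2) S2 S1 ++ S2)) := by
  subst hr
  obtain ⟨q, p, q', p', hdet, hq'₀, hq'q, hp'₀, hp'p, hqp, hr, hnext, hlast⟩ :=
    exists_cfQ_endpoints M hMlen hMpos hMlast
  have hq : 0 < q := by omega
  have hp : 0 < p := by omega
  have hcop : q.Coprime p := by
    rw [← Nat.isCoprime_iff_coprime]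
    rcases neg_one_pow_eq_or ℤ M.length with h | h
    · exact ⟨-p', q', by linarith⟩
    · exact ⟨p', -q', by linarith⟩
  have hr' : cfQ M = ((q : ℤ) : ℚ) / ((p : ℤ) : ℚ) := by rw [hr]; push_cast; rfl
  have hnum : (cfQ M).num = q := by
    rw [hr', Rat.num_div_eq_of_coprime (by exact_mod_cast hp) (by simpa using hcop)]
  have hden : (cfQ M).den = p := by
    have := Rat.den_div_eq_of_coprime (a := q) (b := p) (by exact_mod_cast hp) (by simpa using hcop)
    rw [hr']
    exact_mod_cast this
  have hpQ : (0 : ℚ) < p := by exact_mod_cast hp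
  have hqQ : (0 : ℚ) < q := by exact_mod_cast hq
  have hr₀ : 0 < cfQ M := by rw [hr]; positivity
  have hr₁ : cfQ M ≤ 1 := by rw [hr, div_le_one hpQ]; exact_mod_cast hqp
  rw [CS_eq_map_runLen hr₀ hr₁, hnum, hden, Int.toNat_natCast] at hdec
  obtain ⟨d, hd⟩ : ∃ d, 2 * n - 2 = d + 2 := ⟨2 * n - 4, by omega⟩
  have hd₀ : (0 : ℚ) ≤ d := by positivity
  have hnext' := hnext (d + 2) (by omega)
  have hp'Q : (p' : ℚ) < p := by exact_mod_cast hp'p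
  have hq'Q : (q' : ℚ) < q := by exact_mod_cast hq'q
  have hp'Q₀ : (0 : ℚ) < p' := by exact_mod_cast hp'₀
  have hq'Q₀ : (0 : ℚ) < q' := by exact_mod_cast hq'₀
  have hqpQ : (q : ℚ) ≤ p := by exact_mod_cast hqp
  rw [hd]
  simp only [memI1, memI2, hd, hnext', hlast] at hs
  push_cast at hs
  rw [le_div_iff₀ (by linarith), lt_div_iff₀ (by positivity), div_lt_iff₀ (by positivity),
    div_le_iff₀ (by linarith)] at hs
  constructor
  · intro heven hcon
    rw [if_pos heven, if_pos heven] at hs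
    rw [heven.neg_one_pow] at hdet
    obtain ⟨hl, hσ, hl', hσ'⟩ := palindrome_length_sum (u := q') (v := p') hq hqp
      (by zify; linarith) hq'q hdec hS1ne hS2ne hS1pal hS2pal
    replace hdet : (q' * p - p' * q : ℚ) = 1 := by exact_mod_cast hdet
    have e₁ : (S1.length : ℚ) = q' := by rw [hl]
    have e₂ : (S2.length : ℚ) = q - q' := by rw [← hl', Nat.cast_add, e₁]; ring
    have e₃ : (S1.sum : ℚ) = p' + 1 := by rw [hσ, Nat.cast_add, Nat.cast_one]
    have e₄ : (S2.sum : ℚ) = p - p' - 1 := by rw [← hσ', Nat.cast_add, e₃]; ring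
    rcases hs with ⟨hs₀, hs₂⟩ | ⟨hs₂, hs₁⟩
    · have hsp : s * p ≤ q := by
        refine le_of_mul_le_mul_right ?_ (show (0 : ℚ) < 2 * p - p' by linarith)
        linarith [mul_le_mul_of_nonneg_left hs₂ hpQ.le]
      have hs₁ : s ≤ 1 := le_of_mul_le_mul_right (by linarith) hpQ
      obtain rfl | hs₀ := hs₀.eq_or_lt
      · exact not_cyclicContains_CS_zero (d + 1) hS1ne hcon
      · obtain ⟨-, -, h⟩ := bounds_of_cyclicContains (d := d + 1) hs₀ hs₁ hcon
        rw [e₁, e₂, e₃, e₄] at h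
        push_cast at h
        linarith [mul_nonneg hd₀ (sub_nonneg.2 hsp)]
    · have hs₀ : 0 < s := by
        refine pos_of_mul_pos_left (lt_trans ?_ hs₂) ?_ <;> positivity
      obtain ⟨⟨h, -⟩, -⟩ := bounds_of_cyclicContains (d := d + 1) hs₀ hs₁ hcon
      rw [e₁, e₂, e₃, e₄] at h
      push_cast at h
      linarith
  · intro hodd hcon
    rw [if_neg hodd, if_neg hodd] at hs
    rw [(Nat.not_even_iff_odd.1 hodd).neg_one_pow] at hdet
    obtain ⟨hl, hσ, hl', hσ'⟩ := palindrome_length_sum (u := q - q') (v := p - p') hq hqp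
      (by zify [hq'q.le, hp'p.le]; linarith) (by omega) hdec hS1ne hS2ne hS1pal hS2pal
    replace hdet : (q' * p - p' * q : ℚ) = -1 := by exact_mod_cast hdet
    have e₁ : (S1.length : ℚ) = q - q' := by rw [hl, Nat.cast_sub hq'q.le]
    have e₂ : (S2.length : ℚ) = q' := by
      have : (q : ℚ) = S1.length + S2.length := by rw [← hl', Nat.cast_add]
      linarith
    have e₃ : (S1.sum : ℚ) = p - p' + 1 := by
      rw [hσ, Nat.cast_add, Nat.cast_one, Nat.cast_sub hp'p.le]
    have e₄ : (S2.sum : ℚ) = p' - 1 := by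
      have : (p : ℚ) = S1.sum + S2.sum := by rw [← hσ', Nat.cast_add]
      linarith
    rcases hs with ⟨hs₀, hs₂⟩ | ⟨hs₂, hs₁⟩
    · have hqp' : (q' : ℚ) ≤ p' := by
        refine le_of_mul_le_mul_right ?_ hpQ
        linarith [mul_le_mul_of_nonneg_left hqpQ hp'Q₀.le]
      have hs₁ : s ≤ 1 := by
        refine le_of_mul_le_mul_right ?_ (show (0 : ℚ) < (d + 2) * p + p' by positivity)
        linarith [mul_le_mul_of_nonneg_left hqpQ hd₀]
      obtain rfl | hs₀ := hs₀.eq_or_lt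
      · exact not_cyclicContains_CS_zero (d + 1) hS2ne hcon
      · obtain ⟨⟨-, h⟩, -⟩ := bounds_of_cyclicContains (d := d + 1) hs₀ hs₁ hcon
        rw [e₁, e₂, e₃, e₄] at h
        push_cast at h
        linarith
    · have hs₀ : 0 < s :=
        pos_of_mul_pos_left (show 0 < s * (2 * p - p') by linarith) (by linarith)
      have hsp : q ≤ s * p := by
        refine le_of_mul_le_mul_right ?_ (show (0 : ℚ) < 2 * p - p' by linarith)
        linarith [mul_le_mul_of_nonneg_left hs₂ hpQ.le]
      obtain ⟨-, h, -⟩ := bounds_of_cyclicContains (d := d + 1) hs₀ hs₁ hcon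
      rw [e₁, e₂, e₃, e₄] at h
      push_cast at h
      linarith [mul_nonneg hd₀ (sub_nonneg.2 hsp)]

end Heckoid
end
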